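/- Let k ≥ 0 and n̄ = (n_1,…,n_r) with r ≥ 1 and n_i ≥ 1 for all i. Let [r] = A ⊎ B be a partition with B ⊇ S := {i ∈ [r] : n_i = 1}, and set n_B := Σ_{i∈B} n_i, K_1 := Σ_{i∈A} ⌊(n_i − 2)/2⌋ + max{0, ⌊(n_B − 1)/2⌋}, and K_2 := |{i ∈ A : n_i is odd}| + (1 if n_B is even and nonzero, otherwise 0). Then every (k,n̄)-PPSN polytope has dimension at least: r + 1 − |B| + 2k if 0 ≤ k ≤ K_1; r + 1 − |B| + K_1 + k if K_1 ≤ k ≤ K_1 + K_2; and r + 1 − |B| + 2K_1 + K_2 if k ≥ K_1 + K_2. -/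

import Mathlib

open Set

section PolytopeDefs

variable {E : Type*} [AddCommGroup E] [Module ℝ E]
variable {E' : Type*} [AddCommGroup E'] [Module ℝ E']

/-- A polytope: the convex hull of a finite set of points. -/
def IsPolytope (P : Set E) : Prop :=
  ∃ V : Finset E, P = convexHull ℝ (V : Set E)

/-- The dimension of a set of points: the dimension of its affine span. -/
noncomputable def polyDim (P : Set E) : ℕ :=
  Module.finrank ℝ (affineSpan ℝ P).direction

/-- A nonempty exposed face of `P`: a nonempty set of the form
`{x ∈ P | ⟨c,x⟩ = max_{y ∈ P} ⟨c,y⟩}` for a linear functional `c`. -/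
def IsFace (P F : Set E) : Prop :=
  F.Nonempty ∧ ∃ c : E →ₗ[ℝ] ℝ, F = {x ∈ P | ∀ y ∈ P, c y ≤ c x}

/-- The `k`-skeleton of `P`: its nonempty faces of dimension at most `k`. -/
def skel (k : ℕ) (P : Set E) : Set (Set E) :=
  {F | IsFace P F ∧ polyDim F ≤ k}

/-- The set of all nonempty faces of `P`. -/
def facesOf (P : Set E) : Set (Set E) :=
  {F | IsFace P F}

/-- Combinatorial equivalence of `k`-skeletons: the posets of faces of dimension
at most `k`, ordered by inclusion, are order-isomorphic. -/
def SkelEquiv (k : ℕ) (P : Set E) (Q : Set E') : Prop :=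
  Nonempty (skel k P ≃o skel k Q)

end PolytopeDefs

/-- The product of standard simplices `Δ_{n 0} × ⋯ × Δ_{n (r-1)}`. -/
def prodSimplex {r : ℕ} (n : Fin r → ℕ) : Set ((i : Fin r) → Fin (n i + 1) → ℝ) :=
  Set.univ.pi fun i => stdSimplex ℝ (Fin (n i + 1))

/-- `P` is `(k, n̄)`-prodsimplicial-neighborly: it is a polytope whose `k`-skeleton
is combinatorially equivalent to that of the product of simplices `Δ_n̄`. -/
def IsPSN {E : Type*} [AddCommGroup E] [Module ℝ E] (k : ℕ) {r : ℕ} (n : Fin r → ℕ)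
    (P : Set E) : Prop :=
  IsPolytope P ∧ SkelEquiv k P (prodSimplex n)

/-- `P` is `(k, n̄)`-projected-prodsimplicial-neighborly: it is `(k, n̄)`-PSN and moreover
the image under a linear map of a polytope whose poset of all nonempty faces is
order-isomorphic to that of `Δ_n̄`. -/
def IsPPSN {E : Type*} [AddCommGroup E] [Module ℝ E] (k : ℕ) {r : ℕ} (n : Fin r → ℕ)
    (P : Set E) : Prop :=
  IsPSN k n P ∧ ∃ (N : ℕ) (Q : Set (Fin N → ℝ)) (f : (Fin N → ℝ) →ₗ[ℝ] E),
    IsPolytope Q ∧ P = f '' Q ∧ Nonempty (facesOf Q ≃o facesOf (prodSimplex n))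

/-- The augmented simplicial boundary, modulo two, of an ordered simplex. -/
noncomputable def listBoundary {E : Type*} : List E → (List E →₀ ZMod 2)
  | [] => 0
  | x :: l =>
    Finsupp.single l 1 + Finsupp.lmapDomain (ZMod 2) (ZMod 2) (List.cons x) (listBoundary l)

/-- The boundary operator on chains of ordered simplices. -/
noncomputable def chainBoundary {E : Type*} : (List E →₀ ZMod 2) →ₗ[ZMod 2] (List E →₀ ZMod 2) :=
  Finsupp.linearCombination (ZMod 2) listBoundary

/-- The map on chains induced by a map of lists. -/
noncomputable abbrev chainMap {E F : Type*} (f : List E → List F) :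
    (List E →₀ ZMod 2) →ₗ[ZMod 2] (List F →₀ ZMod 2) :=
  Finsupp.lmapDomain (ZMod 2) (ZMod 2) f

/-- The prism on an ordered simplex spanned by two maps. -/
noncomputable def listPrism {E F : Type*} (φ ψ : E → F) : List E → (List F →₀ ZMod 2)
  | [] => 0
  | x :: l =>
    Finsupp.single (φ x :: ψ x :: l.map ψ) 1 + chainMap (List.cons (φ x)) (listPrism φ ψ l)

/-- The prism operator on chains. -/
noncomputable def chainPrism {E F : Type*} (φ ψ : E → F) :
    (List E →₀ ZMod 2) →ₗ[ZMod 2] (List F →₀ ZMod 2) :=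
  Finsupp.linearCombination (ZMod 2) (listPrism φ ψ)

@[simp] theorem chainBoundary_single {E : Type*} (l : List E) :
    chainBoundary (Finsupp.single l 1) = listBoundary l := by
  simp [chainBoundary]

@[simp] theorem chainPrism_single {E F : Type*} (φ ψ : E → F) (l : List E) :
    chainPrism φ ψ (Finsupp.single l 1) = listPrism φ ψ l := by
  simp [chainPrism]

theorem chainMap_single {E F : Type*} (f : List E → List F) (l : List E) :
    chainMap f (Finsupp.single l 1) = Finsupp.single (f l) 1 := by
  simp

theorem chainMap_comp {E F G : Type*} (g : List F → List G) (f : List E → List F)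
    (c : List E →₀ ZMod 2) : chainMap g (chainMap f c) = chainMap (fun l => g (f l)) c := by
  simp only [Finsupp.lmapDomain_apply, ← Finsupp.mapDomain_comp]
  rfl

/-- Linear maps on chains agree when they agree on simplices. -/
theorem chain_hom_ext {E M : Type*} [AddCommGroup M] [Module (ZMod 2) M]
    {f g : (List E →₀ ZMod 2) →ₗ[ZMod 2] M}
    (h : ∀ l, f (Finsupp.single l 1) = g (Finsupp.single l 1)) (c : List E →₀ ZMod 2) :
    f c = g c := by
  have : f = g := by
    ext l
    simpa using h l
  rw [this]

theorem chainBoundary_cons {E : Type*} (x : E) (c : List E →₀ ZMod 2) :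
    chainBoundary (chainMap (List.cons x) c) = c + chainMap (List.cons x) (chainBoundary c) := by
  refine chain_hom_ext (f := chainBoundary ∘ₗ chainMap (List.cons x))
    (g := LinearMap.id + chainMap (List.cons x) ∘ₗ chainBoundary) (fun l => ?_) c
  simp [listBoundary]

theorem chainBoundary_map {E F : Type*} (φ : E → F) (c : List E →₀ ZMod 2) :
    chainBoundary (chainMap (List.map φ) c) = chainMap (List.map φ) (chainBoundary c) := by
  refine chain_hom_ext (f := chainBoundary ∘ₗ chainMap (List.map φ))
    (g := chainMap (List.map φ) ∘ₗ chainBoundary) (fun l => ?_) c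
  simp only [LinearMap.comp_apply, chainMap_single, chainBoundary_single]
  induction l with
  | nil => simp [listBoundary]
  | cons x l ih =>
    simp only [List.map_cons, listBoundary, ih, map_add, chainMap_comp, chainMap_single]

theorem chainPrism_cons {E F : Type*} (φ ψ : E → F) (x : E) (c : List E →₀ ZMod 2) :
    chainPrism φ ψ (chainMap (List.cons x) c) =
      chainMap (fun l => φ x :: ψ x :: l.map ψ) c
        + chainMap (List.cons (φ x)) (chainPrism φ ψ c) := by
  refine chain_hom_ext (f := chainPrism φ ψ ∘ₗ chainMap (List.cons x))
    (g := chainMap (fun l => φ x :: ψ x :: l.map ψ) + chainMap (List.cons (φ x)) ∘ₗ chainPrism φ ψ)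
    (fun l => ?_) c
  simp [listPrism]

theorem chainBoundary_prism {E F : Type*} (φ ψ : E → F) (c : List E →₀ ZMod 2) :
    chainBoundary (chainPrism φ ψ c) =
      chainMap (List.map φ) c + chainMap (List.map ψ) c + chainPrism φ ψ (chainBoundary c) := by
  refine chain_hom_ext (f := chainBoundary ∘ₗ chainPrism φ ψ)
    (g := chainMap (List.map φ) + chainMap (List.map ψ) + chainPrism φ ψ ∘ₗ chainBoundary)
    (fun l => ?_) c
  simp only [LinearMap.comp_apply, LinearMap.add_apply, chainMap_single, chainBoundary_single,
    chainPrism_single]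
  induction l with
  | nil => simp [listBoundary, listPrism, ZModModule.add_self]
  | cons x l ih =>
    have hψ : listBoundary (l.map ψ) = chainMap (List.map ψ) (listBoundary l) := by
      have := chainBoundary_map ψ (Finsupp.single l 1)
      rwa [chainMap_single, chainBoundary_single, chainBoundary_single] at this
    have hc : chainMap (List.cons (φ x)) (chainMap (List.cons (ψ x))
        (chainMap (List.map ψ) (listBoundary l))) =
        chainMap (fun l => φ x :: ψ x :: l.map ψ) (listBoundary l) := by
      rw [chainMap_comp, chainMap_comp]
    simp only [listPrism, listBoundary, map_add, chainBoundary_single, chainBoundary_cons, ih, hψ,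
      chainPrism_cons, chainPrism_single, List.map_cons, chainMap_single, hc]
    generalize chainMap (fun l => φ x :: ψ x :: l.map ψ) (listBoundary l) = a
    have h2 : ∀ y : List F →₀ ZMod 2, y + y = 0 := ZModModule.add_self
    generalize Finsupp.single (φ x :: List.map ψ l) (1 : ZMod 2) = b
    refine Eq.trans ?_ (add_zero _)
    rw [← h2 b]
    abel

theorem listPrism_support {E F : Type*} (φ ψ : E → F) (l : List E) :
    listPrism φ ψ l ∈ Finsupp.supported (ZMod 2) (ZMod 2)
      {l' : List F | l'.length = l.length + 1 ∧ ∀ y ∈ l', ∃ x ∈ l, y = φ x ∨ y = ψ x} := by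
  induction l with
  | nil => exact Submodule.zero_mem _
  | cons x l ih =>
    refine Submodule.add_mem _ (Finsupp.single_mem_supported _ _ ?_) ?_
    · refine ⟨by simp, fun y hy => ?_⟩
      simp only [List.mem_cons, List.mem_map] at hy
      rcases hy with rfl | rfl | ⟨z, hz, rfl⟩
      · exact ⟨x, by simp, Or.inl rfl⟩
      · exact ⟨x, by simp, Or.inr rfl⟩
      · exact ⟨z, by simp [hz], Or.inr rfl⟩
    · classical
      rw [Finsupp.mem_supported] at ih ⊢
      intro l' hl'
      obtain ⟨l'', h'', rfl⟩ := Finset.mem_image.1 (Finsupp.mapDomain_support hl')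
      obtain ⟨h1, h2⟩ := ih h''
      refine ⟨by simp [h1], fun y hy => ?_⟩
      rcases List.mem_cons.1 hy with rfl | hy
      · exact ⟨x, by simp, Or.inl rfl⟩
      · obtain ⟨z, hz, h⟩ := h2 y hy
        exact ⟨z, by simp [hz], h⟩

theorem linear_mem_supported {E F : Type*} (L : (List E →₀ ZMod 2) →ₗ[ZMod 2] (List F →₀ ZMod 2))
    {s : Set (List E)} {t : Set (List F)}
    (h : ∀ l ∈ s, L (Finsupp.single l 1) ∈ Finsupp.supported (ZMod 2) (ZMod 2) t)
    {c : List E →₀ ZMod 2} (hc : c ∈ Finsupp.supported (ZMod 2) (ZMod 2) s) :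
    L c ∈ Finsupp.supported (ZMod 2) (ZMod 2) t := by
  rw [← Finsupp.sum_single c, Finsupp.sum, map_sum]
  refine Submodule.sum_mem _ fun l hl => ?_
  have : Finsupp.single l (c l) = c l • Finsupp.single l (1 : ZMod 2) := by simp
  rw [this, map_smul]
  exact Submodule.smul_mem _ _ (h l (hc hl))

section Alternation

variable {E : Type*} (s : E → Bool) (κ : E → ℕ)

/-- The indicator modulo two of lists whose signs alternate, the first one being `b`. -/
def altIndicator : Bool → List E → ZMod 2
  | _, [] => 1
  | b, x :: l => if s x = b then altIndicator (!b) l else 0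

/-- Sorting a list by the values of `κ`. -/
def keySort (l : List E) : List E := l.insertionSort (fun x y => κ x ≤ κ y)

theorem linearCombination_chainMap (f : List E → ZMod 2) {F : Type*} (g : List F → List E)
    (c : List F →₀ ZMod 2) :
    Finsupp.linearCombination (ZMod 2) f (chainMap g c) =
      Finsupp.linearCombination (ZMod 2) (fun l => f (g l)) c := by
  refine chain_hom_ext (f := Finsupp.linearCombination (ZMod 2) f ∘ₗ chainMap g)
    (g := Finsupp.linearCombination (ZMod 2) (fun l => f (g l))) (fun l => ?_) c
  simp

theorem alt_cons (b : Bool) (x : E) (c : List E →₀ ZMod 2) :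
    Finsupp.linearCombination (ZMod 2) (altIndicator s b) (chainMap (List.cons x) c) =
      if s x = b then Finsupp.linearCombination (ZMod 2) (altIndicator s (!b)) c else 0 := by
  rw [linearCombination_chainMap]
  split_ifs with h
  · simp [altIndicator, h]
  · simp [altIndicator, h, Finsupp.linearCombination_apply]

theorem alt_listBoundary (b : Bool) (x : E) (l : List E) :
    Finsupp.linearCombination (ZMod 2) (altIndicator s b) (listBoundary (x :: l)) =
      altIndicator s b (x :: l) + altIndicator s (!b) (x :: l) := by
  induction l generalizing x b with
  | nil => 
    cases h : s x <;> cases b <;> simp [listBoundary, altIndicator, h]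
  | cons y l ih =>
    rw [listBoundary, map_add, alt_cons, ih]
    have h2 : ∀ y : ZMod 2, y + y = 0 := ZModModule.add_self
    have h3 := h2 (altIndicator s b (y :: l))
    have h4 : altIndicator s b (x :: y :: l) =
      if s x = b then altIndicator s (!b) (y :: l) else 0 := rfl
    have h5 : altIndicator s (!b) (x :: y :: l) =
      if s x = !b then altIndicator s b (y :: l) else 0 := by
        conv_lhs => rw [altIndicator, Bool.not_not]
    rw [h4, h5, Finsupp.linearCombination_single, one_smul, Bool.not_not]
    by_cases h : s x = b
    · have h' : s x ≠ !b := by simp [h]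
      rw [if_pos h, if_pos h, if_neg h']
      linear_combination h3
    · have h' : s x = !b := by cases b <;> simpa using h
      rw [if_neg h, if_neg h, if_pos h']
      ring

theorem pairwise_keySort (l : List E) : (keySort κ l).Pairwise (fun x y => κ x ≤ κ y) := by
  have : Std.Total (fun x y : E => κ x ≤ κ y) := ⟨fun x y => le_total _ _⟩
  have : IsTrans E (fun x y : E => κ x ≤ κ y) := ⟨fun x y z => le_trans⟩
  exact List.pairwise_insertionSort _ l

theorem listBoundary_orderedInsert (a : E) (l : List E)
    (hl : l.Pairwise (fun x y => κ x ≤ κ y)) :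
    listBoundary (l.orderedInsert (fun x y => κ x ≤ κ y) a) =
      Finsupp.single l 1 +
        chainMap (List.orderedInsert (fun x y => κ x ≤ κ y) a) (listBoundary l) := by
  have h2 : ∀ y : List E →₀ ZMod 2, y + y = 0 := ZModModule.add_self
  induction l with
  | nil => simp [listBoundary]
  | cons b l ih =>
    rw [List.pairwise_cons] at hl
    by_cases h : κ a ≤ κ b
    · have h1 : l.orderedInsert (fun x y => κ x ≤ κ y) a = a :: l := by
        cases l with
        | nil => simp
        | cons c l => simp [h.trans (hl.1 c (by simp))]
      have h3 : ∀ l : List E, (b :: l).orderedInsert (fun x y => κ x ≤ κ y) a = a :: b :: l :=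
        fun l => by simp [h]
      simp only [h3, listBoundary, map_add, chainMap_single, chainMap_comp, h1]
    · have h3 : ∀ l : List E, (b :: l).orderedInsert (fun x y => κ x ≤ κ y) a =
        b :: l.orderedInsert (fun x y => κ x ≤ κ y) a := fun l => by simp [h]
      simp only [h3, listBoundary, map_add, chainMap_single, chainMap_comp, ih hl.2]
      abel

theorem chainMap_keySort_listBoundary (l : List E) :
    chainMap (keySort κ) (listBoundary l) = listBoundary (keySort κ l) := by
  induction l with
  | nil => simp [listBoundary, keySort]
  | cons a l ih =>
    have h1 : ∀ l, keySort κ (a :: l) = (keySort κ l).orderedInsert (fun x y => κ x ≤ κ y) a :=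
      fun _ => rfl
    rw [h1, listBoundary_orderedInsert _ _ _ (pairwise_keySort κ l), ← ih, listBoundary, map_add,
      chainMap_single, chainMap_comp, chainMap_comp]
    rfl

/-- Counts modulo two the simplices whose sorted signs alternate, starting with `b`. -/
noncomputable def altCount (b : Bool) : (List E →₀ ZMod 2) →ₗ[ZMod 2] ZMod 2 :=
  Finsupp.linearCombination (ZMod 2) (fun l => altIndicator s b (keySort κ l))

theorem altCount_boundary (b : Bool) (c : List E →₀ ZMod 2)
    (hc : c ∈ Finsupp.supported (ZMod 2) (ZMod 2) {l : List E | l ≠ []}) :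
    altCount s κ b (chainBoundary c) = altCount s κ b c + altCount s κ (!b) c := by
  rw [← Finsupp.sum_single c, Finsupp.sum]
  simp only [map_sum, ← Finset.sum_add_distrib]
  refine Finset.sum_congr rfl fun l hl => ?_
  have hl' : l ≠ [] := hc hl
  have : Finsupp.single l (c l) = c l • Finsupp.single l (1 : ZMod 2) := by simp
  rw [this]
  simp only [map_smul, ← smul_add]
  congr 1
  rw [chainBoundary_single]
  have hs : keySort κ l ≠ [] := by
    intro h
    apply hl'
    have := List.perm_insertionSort (fun x y => κ x ≤ κ y) l
    rw [show l.insertionSort (fun x y => κ x ≤ κ y) = [] from h] at this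
    exact this.symm.eq_nil
  rw [altCount, ← linearCombination_chainMap (altIndicator s b) (keySort κ),
    chainMap_keySort_listBoundary]
  obtain ⟨x, l', h'⟩ := List.exists_cons_of_ne_nil hs
  rw [altCount]
  simp only [Finsupp.linearCombination_single, one_smul]
  rw [h', alt_listBoundary]

theorem altIndicator_map_neg [Neg E] (b : Bool) (l : List E) (hs : ∀ x ∈ l, s (-x) = !s x) :
    altIndicator s b (l.map Neg.neg) = altIndicator s (!b) l := by
  induction l generalizing b with
  | nil => rfl
  | cons x l ih =>
    simp only [List.map_cons, altIndicator, hs x (by simp), ih _ fun y hy => hs y (by simp [hy])]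
    cases s x <;> cases b <;> simp

theorem altCount_neg [Neg E] (hκ : ∀ x, κ (-x) = κ x) (b : Bool) (c : List E →₀ ZMod 2)
    (hc : c ∈ Finsupp.supported (ZMod 2) (ZMod 2) {l : List E | ∀ x ∈ l, s (-x) = !s x}) :
    altCount s κ b (chainMap (List.map Neg.neg) c) = altCount s κ (!b) c := by
  rw [altCount, linearCombination_chainMap, altCount]
  rw [Finsupp.linearCombination_apply, Finsupp.linearCombination_apply]
  refine Finsupp.sum_congr fun l hl => ?_
  congr 1
  have h1 : keySort κ (l.map Neg.neg) = (keySort κ l).map Neg.neg := by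
    refine (List.map_insertionSort (fun x y => κ x ≤ κ y) (fun x y => κ x ≤ κ y) Neg.neg l ?_).symm
    simp [hκ]
  rw [h1, altIndicator_map_neg]
  intro x hx
  refine hc hl x ?_
  exact (List.perm_insertionSort (fun x y => κ x ≤ κ y) l).mem_iff.1 hx

theorem exists_of_altCount_ne_zero (b : Bool) {c : List E →₀ ZMod 2} {t : Set (List E)}
    (hc : c ∈ Finsupp.supported (ZMod 2) (ZMod 2) t) (h : altCount s κ b c ≠ 0) :
    ∃ l ∈ t, altIndicator s b (keySort κ l) ≠ 0 := by
  rw [altCount, Finsupp.linearCombination_apply] at h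
  obtain ⟨l, hl, h'⟩ := Finset.exists_ne_zero_of_sum_ne_zero h
  exact ⟨l, hc hl, fun h0 => h' (by simp [h0])⟩

/-- In a sorted list with alternating signs the keys increase strictly, provided equal keys force
equal signs. -/
theorem pairwise_lt_of_altIndicator (b : Bool) {l : List E}
    (hl : l.Pairwise (fun x y => κ x ≤ κ y))
    (hs : ∀ x ∈ l, ∀ y ∈ l, κ x = κ y → s x = s y) (h : altIndicator s b l ≠ 0) :
    l.Pairwise (fun x y => κ x < κ y) := by
  induction l generalizing b with
  | nil => exact List.Pairwise.nil
  | cons x l ih =>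
    rw [List.pairwise_cons] at hl
    simp only [altIndicator] at h
    split_ifs at h with hx
    · have h' := ih (!b) hl.2 (fun y hy z hz => hs y (by simp [hy]) z (by simp [hz])) h
      refine List.pairwise_cons.2 ⟨?_, h'⟩
      cases l with
      | nil => simp
      | cons y l =>
        have hxy : κ x < κ y := by
          refine lt_of_le_of_ne (hl.1 y (by simp)) fun he => ?_
          have := hs x (by simp) y (by simp) he
          simp only [altIndicator] at h
          split_ifs at h with hy
          · rw [hx, hy] at this
            cases b <;> simp at this
          · exact h rfl
        intro z hz
        rcases List.mem_cons.1 hz with rfl | hz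
        · exact hxy
        · exact hxy.trans ((List.pairwise_cons.1 h').1 z hz)
    · exact absurd rfl h

end Alternation

theorem dist_lineMap_le {E : Type*} [NormedAddCommGroup E] [NormedSpace ℝ E] {x y v : E}
    {t t' ε δ : ℝ} (ht : t ∈ Set.Icc (0 : ℝ) 1) (hxy : dist x y ≤ ε) (hy : dist y v ≤ 2)
    (htt : dist t t' ≤ δ) :
    dist (AffineMap.lineMap x v t) (AffineMap.lineMap y v t') ≤ ε + δ * 2 := by
  have h1 : dist (AffineMap.lineMap x v t : E) (AffineMap.lineMap y v t) ≤ ε := by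
    have : (AffineMap.lineMap x v t : E) - AffineMap.lineMap y v t = (1 - t) • (x - y) := by
      simp only [AffineMap.lineMap_apply_module]
      module
    rw [dist_eq_norm, this, norm_smul, Real.norm_of_nonneg (by linarith [ht.2]), ← dist_eq_norm]
    have := mul_nonneg ht.1 (dist_nonneg (x := x) (y := y))
    linarith
  have h2 : dist (AffineMap.lineMap y v t : E) (AffineMap.lineMap y v t') ≤ δ * 2 := by
    rw [dist_lineMap_lineMap]
    exact mul_le_mul htt hy dist_nonneg (dist_nonneg.trans htt)
  exact (dist_triangle _ _ _).trans (add_le_add h1 h2)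

/-- A small cycle bounds a small chain inside the cone over its support. -/
theorem exists_small_filling {E : Type*} [NormedAddCommGroup E] [NormedSpace ℝ E] {Y : Set E}
    {v : E} (hv : ∀ x ∈ Y, dist x v ≤ 2) {i : ℕ} {ε ε' : ℝ} (hε : ε < ε') (hε' : 0 ≤ ε')
    {c : List E →₀ ZMod 2}
    (hc : c ∈ Finsupp.supported (ZMod 2) (ZMod 2)
      {l : List E | l.length = i ∧ (∀ x ∈ l, x ∈ Y) ∧ ∀ x ∈ l, ∀ y ∈ l, dist x y ≤ ε})
    (hc0 : chainBoundary c = 0) :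
    ∃ d ∈ Finsupp.supported (ZMod 2) (ZMod 2)
      {l : List E | l.length = i + 1 ∧
        (∀ x ∈ l, x = v ∨ ∃ y ∈ Y, ∃ t ∈ Set.Icc (0 : ℝ) 1, x = AffineMap.lineMap y v t) ∧
        ∀ x ∈ l, ∀ y ∈ l, dist x y ≤ ε'}, chainBoundary d = c := by
  obtain ⟨N, hN⟩ := exists_nat_gt (2 / (ε' - ε))
  have hε0 : 0 < ε' - ε := by linarith
  have hN0 : (0 : ℝ) < N := lt_trans (by positivity) hN
  have hNε : ε + (1 / N) * 2 ≤ ε' := by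
    rw [div_lt_iff₀ hε0] at hN
    have : 2 / (N : ℝ) < ε' - ε := by rw [div_lt_iff₀ hN0]; linarith
    have h2 : 1 / (N : ℝ) * 2 = 2 / N := by ring
    linarith
  let φ : ℕ → E → E := fun s x => AffineMap.lineMap x v ((s : ℝ) / N)
  have hφ0 : φ 0 = id := by ext x; simp [φ]
  have hφN : ∀ x, φ N x = v := by intro x; simp [φ, hN0.ne']
  have hts : ∀ s : ℕ, s ≤ N → (s : ℝ) / N ∈ Set.Icc (0 : ℝ) 1 := fun s hs =>
    ⟨by positivity, by rw [div_le_one hN0]; exact_mod_cast hs⟩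
  refine ⟨∑ s ∈ Finset.range N, chainPrism (φ s) (φ (s + 1)) c +
    chainMap (List.cons v) (chainMap (List.map (φ N)) c), ?_, ?_⟩
  · refine Submodule.add_mem _ (Submodule.sum_mem _ fun s hs => ?_) ?_
    · refine linear_mem_supported _ (fun l hl => ?_) hc
      rw [chainPrism_single]
      refine Finsupp.supported_mono ?_ (listPrism_support (φ s) (φ (s + 1)) l)
      rintro l' ⟨h1, h2⟩
      have hs : s < N := Finset.mem_range.1 hs
      have key : ∀ y ∈ l', ∃ x ∈ l, ∃ u : ℕ, (u = s ∨ u = s + 1) ∧ y = φ u x := by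
        intro y hy
        obtain ⟨x, hx, h | h⟩ := h2 y hy
        exacts [⟨x, hx, s, Or.inl rfl, h⟩, ⟨x, hx, s + 1, Or.inr rfl, h⟩]
      have hle : ∀ u : ℕ, (u = s ∨ u = s + 1) → u ≤ N := by
        rintro u (rfl | rfl) <;> omega
      refine ⟨by rw [h1, hl.1], fun y hy => ?_, fun y hy y' hy' => ?_⟩
      · obtain ⟨x, hx, u, hu, rfl⟩ := key y hy
        exact Or.inr ⟨x, hl.2.1 x hx, _, hts u (hle u hu), rfl⟩
      · obtain ⟨x, hx, u, hu, rfl⟩ := key y hy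
        obtain ⟨x', hx', u', hu', rfl⟩ := key y' hy'
        refine (dist_lineMap_le (hts u (hle u hu)) (hl.2.2 x hx x' hx') (hv _ (hl.2.1 x' hx'))
          (?_ : _ ≤ 1 / (N : ℝ))).trans hNε
        rw [Real.dist_eq, ← sub_div, abs_div, abs_of_pos hN0]
        gcongr
        rcases hu with rfl | rfl <;> rcases hu' with rfl | rfl <;> simp
    · refine linear_mem_supported _ (fun l hl => ?_)
        (linear_mem_supported (t := {l | l.length = i ∧ ∀ x ∈ l, x = v}) _ (fun l hl => ?_) hc)
      · rw [chainMap_single]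
        refine Finsupp.single_mem_supported _ _ ?_
        have : ∀ x ∈ v :: l, x = v := by
          intro x hx
          rcases List.mem_cons.1 hx with rfl | hx
          exacts [rfl, hl.2 x hx]
        refine ⟨by simp [hl.1], fun x hx => Or.inl (this x hx), fun x hx y hy => ?_⟩
        rw [this x hx, this y hy, dist_self]
        exact hε'
      · rw [chainMap_single]
        refine Finsupp.single_mem_supported _ _ ?_
        refine ⟨by simp [hl.1], fun x hx => ?_⟩
        obtain ⟨y, -, rfl⟩ := List.mem_map.1 hx
        exact hφN y
  · have htel : ∀ M : ℕ, ∑ s ∈ Finset.range M,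
        (chainMap (List.map (φ s)) c + chainMap (List.map (φ (s + 1))) c) =
        c + chainMap (List.map (φ M)) c := by
      intro M
      induction M with
      | zero =>
        have : (List.map id : List E → List E) = id := by ext1 l; simp
        rw [hφ0, this]
        simp [ZModModule.add_self]
      | succ M ih =>
        rw [Finset.sum_range_succ, ih]
        refine Eq.trans ?_ (add_zero _)
        rw [← ZModModule.add_self (chainMap (List.map (φ M)) c)]
        abel
    simp only [map_add, map_sum, chainBoundary_prism, chainBoundary_cons, chainBoundary_map, hc0,
      map_zero, add_zero]
    rw [htel, add_assoc, ZModModule.add_self, add_zero]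

/-- The boundary of the cross-polytope in the span of the first `i` coordinates. -/
def crossSphere (m i : ℕ) : Set (Fin m → ℝ) :=
  {x | ∑ j, |x j| = 1 ∧ ∀ j : Fin m, i ≤ (j : ℕ) → x j = 0}

theorem neg_mem_crossSphere {m i : ℕ} {x : Fin m → ℝ} (hx : x ∈ crossSphere m i) :
    -x ∈ crossSphere m i :=
  ⟨by simpa using hx.1, fun j hj => by simp [hx.2 j hj]⟩

theorem norm_le_of_mem_crossSphere {m i : ℕ} {x : Fin m → ℝ} (hx : x ∈ crossSphere m i) :
    ‖x‖ ≤ 1 := by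
  rw [pi_norm_le_iff_of_nonneg zero_le_one]
  intro j
  rw [← hx.1, Real.norm_eq_abs]
  exact Finset.single_le_sum (f := fun j => |x j|) (fun _ _ => abs_nonneg _) (Finset.mem_univ j)

theorem crossSphere_mono {m i i' : ℕ} (h : i ≤ i') : crossSphere m i ⊆ crossSphere m i' :=
  fun _ hx => ⟨hx.1, fun j hj => hx.2 j (h.trans hj)⟩

theorem single_mem_crossSphere {m : ℕ} (i : Fin m) :
    (Pi.single i 1 : Fin m → ℝ) ∈ crossSphere m (i + 1) := by
  refine ⟨?_, fun j hj => ?_⟩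
  · rw [Finset.sum_eq_single i (fun j _ hj => by simp [hj]) (by simp)]
    simp
  · exact Pi.single_eq_of_ne (by rintro rfl; omega) _

theorem lineMap_mem_crossSphere {m : ℕ} (i : Fin m) {x : Fin m → ℝ} (hx : x ∈ crossSphere m i)
    {t : ℝ} (ht : t ∈ Set.Icc (0 : ℝ) 1) :
    AffineMap.lineMap x (Pi.single i 1) t ∈ crossSphere m (i + 1) := by
  have hv := single_mem_crossSphere i
  have h0 : ∀ j, |(AffineMap.lineMap x (Pi.single i 1) t : Fin m → ℝ) j| =
      (1 - t) * |x j| + t * |(Pi.single i 1 : Fin m → ℝ) j| := by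
    intro j
    simp only [AffineMap.lineMap_apply_module, Pi.add_apply, Pi.smul_apply, smul_eq_mul]
    by_cases hj : j = i
    · subst hj
      simp [hx.2 j le_rfl, abs_of_nonneg ht.1]
    · simp [hj, abs_mul, abs_of_nonneg (sub_nonneg.2 ht.2)]
  refine ⟨?_, fun j hj => ?_⟩
  · simp only [h0, Finset.sum_add_distrib, ← Finset.mul_sum, hx.1, hv.1]
    ring
  · simp [AffineMap.lineMap_apply_module, hx.2 j (by omega), hv.2 j hj]

/-- A discrete Borsuk-Ulam theorem: for an antipodal colouring of the sphere there are arbitrarily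
small simplices whose signs alternate when sorted by colour. -/
theorem exists_alternating_list {m : ℕ} (s : (Fin m → ℝ) → Bool) (κ : (Fin m → ℝ) → ℕ)
    (hs : ∀ x ∈ crossSphere m m, s (-x) = !s x) (hκ : ∀ x, κ (-x) = κ x) {ε : ℝ} (hε : 0 < ε) :
    ∃ l : List (Fin m → ℝ), l.length = m ∧ (∀ x ∈ l, x ∈ crossSphere m m) ∧
      (∀ x ∈ l, ∀ y ∈ l, dist x y ≤ ε) ∧ altIndicator s true (keySort κ l) ≠ 0 := by
  suffices H : ∀ i ≤ m, ∀ ε > 0, ∃ c ∈ Finsupp.supported (ZMod 2) (ZMod 2)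
      {l : List (Fin m → ℝ) | l.length = i ∧ (∀ x ∈ l, x ∈ crossSphere m i) ∧
        ∀ x ∈ l, ∀ y ∈ l, dist x y ≤ ε}, chainBoundary c = 0 ∧ chainMap (List.map Neg.neg) c = c ∧
        altCount s κ true c = 1 by
    obtain ⟨c, hc, -, -, h1⟩ := H m le_rfl ε hε
    obtain ⟨l, hl, h⟩ := exists_of_altCount_ne_zero s κ true hc (by rw [h1]; exact one_ne_zero)
    exact ⟨l, hl.1, hl.2.1, hl.2.2, h⟩
  intro i
  induction i with
  | zero =>
    intro _ ε _
    refine ⟨Finsupp.single [] 1, Finsupp.single_mem_supported _ _ (by simp), ?_, ?_, ?_⟩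
    · simp [listBoundary]
    · simp
    · simp [altCount, keySort, altIndicator]
  | succ i ih =>
    intro hi ε hε
    obtain ⟨c, hc, hc0, hcn, hc1⟩ := ih (by omega) (ε / 2) (by positivity)
    let i' : Fin m := ⟨i, hi⟩
    have hv := single_mem_crossSphere i'
    obtain ⟨d, hd, hdc⟩ := exists_small_filling (v := Pi.single i' 1) (ε' := ε) (fun x hx => by
      rw [dist_eq_norm]
      exact (norm_sub_le _ _).trans
        ((add_le_add (norm_le_of_mem_crossSphere hx) (norm_le_of_mem_crossSphere hv)).trans
          (by norm_num))) (half_lt_self hε) hε.le hc hc0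
    have hd' : d ∈ Finsupp.supported (ZMod 2) (ZMod 2)
        {l : List (Fin m → ℝ) | l.length = i + 1 ∧ (∀ x ∈ l, x ∈ crossSphere m (i + 1)) ∧
          ∀ x ∈ l, ∀ y ∈ l, dist x y ≤ ε} := by
      refine Finsupp.supported_mono ?_ hd
      rintro l ⟨h1, h2, h3⟩
      refine ⟨h1, fun x hx => ?_, h3⟩
      rcases h2 x hx with rfl | ⟨y, hy, t, ht, rfl⟩
      · exact hv
      · exact lineMap_mem_crossSphere i' hy ht
    refine ⟨d + chainMap (List.map Neg.neg) d, Submodule.add_mem _ hd'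
      (linear_mem_supported _ (fun l hl => ?_) hd'), ?_, ?_, ?_⟩
    · rw [chainMap_single]
      refine Finsupp.single_mem_supported _ _ ⟨by simp [hl.1], fun x hx => ?_, fun x hx y hy => ?_⟩
      · obtain ⟨z, hz, rfl⟩ := List.mem_map.1 hx
        exact neg_mem_crossSphere (hl.2.1 z hz)
      · obtain ⟨z, hz, rfl⟩ := List.mem_map.1 hx
        obtain ⟨w, hw, rfl⟩ := List.mem_map.1 hy
        rw [dist_neg_neg]
        exact hl.2.2 z hz w hw
    · rw [map_add, chainBoundary_map, hdc, hcn, ZModModule.add_self]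
    · have : (fun l : List (Fin m → ℝ) => (l.map Neg.neg).map Neg.neg) = id := by
        ext1 l
        simp
      rw [map_add, chainMap_comp, this, add_comm]
      simp
    · rw [map_add, altCount_neg s κ hκ, ← altCount_boundary, hdc, hc1]
      · refine Finsupp.supported_mono ?_ hd'
        rintro l ⟨hl, -⟩ rfl
        simp at hl
      · refine Finsupp.supported_mono ?_ hd'
        exact fun l hl x hx => hs x (crossSphere_mono hi (hl.2.1 x hx))

/-- If the sphere is covered by `card C` sets, each of them at positive distance from its antipode,
then the dimension of the ambient space is less than `card C`. -/
theorem le_card_sub_one_of_antipodal_cover {m : ℕ} {C : Type*} [Fintype C]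
    (p : C → (Fin m → ℝ) → Prop) (hcov : ∀ x ∈ crossSphere m m, ∃ c, p c x) {ε : ℝ} (hε : 0 < ε)
    (hsep : ∀ x ∈ crossSphere m m, ∀ y ∈ crossSphere m m, dist x y ≤ ε → ∀ c, p c x → ¬p c (-y)) :
    m ≤ Fintype.card C - 1 := by
  classical
  let e := Fintype.equivFin C
  let κ : (Fin m → ℝ) → ℕ := fun x =>
    (Finset.univ.filter fun c => p c x ∨ p c (-x)).sup fun c => (e c : ℕ)
  let s : (Fin m → ℝ) → Bool := fun x => decide (∃ c, (e c : ℕ) = κ x ∧ p c x)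
  have hκ : ∀ x, κ (-x) = κ x := by
    intro x
    simp only [κ, neg_neg, or_comm]
  have hatt : ∀ x ∈ crossSphere m m, ∃ c, (e c : ℕ) = κ x ∧ (p c x ∨ p c (-x)) := by
    intro x hx
    obtain ⟨c, hc⟩ := hcov x hx
    obtain ⟨c', hc', h⟩ := Finset.exists_mem_eq_sup (Finset.univ.filter fun c => p c x ∨ p c (-x))
      ⟨c, by simp [hc]⟩ fun c => (e c : ℕ)
    exact ⟨c', h.symm, (Finset.mem_filter.1 hc').2⟩
  have hinj : ∀ c c', (e c : ℕ) = e c' → c = c' := fun c c' h => e.injective (Fin.ext h)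
  have hs : ∀ x ∈ crossSphere m m, s (-x) = !s x := by
    intro x hx
    obtain ⟨c, hc, h⟩ := hatt x hx
    have h1 : ∀ y, κ y = κ x → (s y = true ↔ p c y) := by
      intro y hy
      simp only [s, decide_eq_true_eq, hy]
      exact ⟨fun ⟨c', h', hp⟩ => by rwa [hinj c c' (hc.trans h'.symm)], fun hp => ⟨c, hc, hp⟩⟩
    have h2 : s (-x) = true ↔ ¬ (s x = true) := by
      rw [h1 _ (hκ x), h1 _ rfl]
      have := hsep x hx x hx (by simpa using hε.le) c
      tauto
    rw [Bool.eq_iff_iff, h2]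
    simp
  have hpos : ∀ x ∈ crossSphere m m, κ x ∈ Finset.Ico 1 (Fintype.card C) := by
    intro x hx
    obtain ⟨c, hc, -⟩ := hatt x hx
    refine Finset.mem_Ico.2 ⟨?_, hc ▸ (e c).2⟩
    obtain ⟨a, ha⟩ := hcov x hx
    obtain ⟨b, hb⟩ := hcov (-x) (neg_mem_crossSphere hx)
    have hab : a ≠ b := by
      rintro rfl
      exact hsep x hx x hx (by simpa using hε.le) a ha hb
    have h1 : (e a : ℕ) ≤ κ x := Finset.le_sup (f := fun c => (e c : ℕ)) (by simp [ha])
    have h2 : (e b : ℕ) ≤ κ x := Finset.le_sup (f := fun c => (e c : ℕ)) (by simp [hb])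
    by_contra h0
    exact hab (hinj a b (by omega))
  obtain ⟨l, hlen, hl, hd, halt⟩ := exists_alternating_list s κ hs hκ hε
  have hmem : ∀ x, x ∈ keySort κ l ↔ x ∈ l := fun x =>
    (List.perm_insertionSort (fun x y => κ x ≤ κ y) l).mem_iff
  have hlt : (keySort κ l).Pairwise (fun x y => κ x < κ y) := by
    refine pairwise_lt_of_altIndicator s κ true (pairwise_keySort κ l) ?_ halt
    suffices H : ∀ x ∈ l, ∀ y ∈ l, κ x = κ y → s x = true → s y = true by
      intro x hx y hy hxy
      rw [hmem] at hx hy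
      rw [Bool.eq_iff_iff]
      exact ⟨H x hx y hy hxy, H y hy x hx hxy.symm⟩
    intro x hx y hy hxy hsx
    simp only [s, decide_eq_true_eq] at hsx ⊢
    obtain ⟨c, hc, hp⟩ := hsx
    obtain ⟨c', hc', h | h⟩ := hatt y (hl y hy)
    · exact ⟨c', hc', h⟩
    · obtain rfl := hinj c c' (by rw [hc, hc', hxy])
      exact absurd h (hsep x (hl x hx) y (hl y hy) (hd x hx y hy) c hp)
  have hnd : ((keySort κ l).map κ).Nodup := by
    rw [List.Nodup, List.pairwise_map]
    exact hlt.imp fun h => h.ne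
  have hsub : ((keySort κ l).map κ).toFinset ⊆ Finset.Ico 1 (Fintype.card C) := by
    intro a ha
    rw [List.mem_toFinset, List.mem_map] at ha
    obtain ⟨x, hx, rfl⟩ := ha
    exact hpos x (hl x ((hmem x).1 hx))
  have := Finset.card_le_card hsub
  rw [List.toFinset_card_of_nodup hnd, List.length_map, keySort, List.length_insertionSort, hlen,
    Nat.card_Ico] at this
  exact this

theorem isCompact_crossSphere (m i : ℕ) : IsCompact (crossSphere m i) := by
  refine Metric.isCompact_of_isClosed_isBounded ?_ ?_
  · have h : crossSphere m i = {x | ∑ j, |x j| = 1} ∩ ⋂ j : Fin m, {x | i ≤ (j : ℕ) → x j = 0} := by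
      ext x
      simp [crossSphere]
    rw [h]
    refine (isClosed_eq (by fun_prop) continuous_const).inter (isClosed_iInter fun j => ?_)
    by_cases hj : i ≤ (j : ℕ)
    · simpa [hj] using isClosed_eq (continuous_apply j) continuous_const
    · simp [hj]
  · exact isBounded_iff_forall_norm_le.2 ⟨1, fun x hx => norm_le_of_mem_crossSphere hx⟩

theorem ne_zero_of_mem_crossSphere {m i : ℕ} {x : Fin m → ℝ} (hx : x ∈ crossSphere m i) :
    x ≠ 0 := by
  rintro rfl
  simpa using hx.1

/-- On a compact set, strict positivity of functionals can be made uniform. -/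
theorem exists_pos_threshold {V : Type*} [TopologicalSpace V] {r K : ℕ} {n : Fin r → ℕ}
    (g : ∀ i, Fin (n i + 1) → V → ℝ) (hg : ∀ i j, Continuous (g i j)) {S : Set V}
    (hS : IsCompact S)
    (h : ∀ x ∈ S, K + 1 ≤ ∑ i, ((Finset.univ.filter fun j => 0 < g i j x).card - 1)) :
    ∃ δ > 0, ∀ x ∈ S, K + 1 ≤ ∑ i, ((Finset.univ.filter fun j => δ < g i j x).card - 1) := by
  classical
  let O : ℕ → Set V := fun N => ⋃ (X : ∀ i, Finset (Fin (n i + 1)))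
    (_ : K + 1 ≤ ∑ i, ((X i).card - 1)), ⋂ i, ⋂ j ∈ X i, {x | 1 / ((N : ℝ) + 1) < g i j x}
  have hO : ∀ N, IsOpen (O N) := fun N => isOpen_iUnion fun X => isOpen_iUnion fun _ =>
    isOpen_iInter_of_finite fun i => isOpen_biInter_finset fun j _ =>
      isOpen_lt continuous_const (hg i j)
  have hmono : ∀ N N', N ≤ N' → O N ⊆ O N' := by
    intro N N' hN x hx
    simp only [O, mem_iUnion, mem_iInter, mem_ofPred_eq, exists_prop] at hx ⊢
    obtain ⟨X, hX, hx⟩ := hx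
    exact ⟨X, hX, fun i j hj => (Nat.one_div_le_one_div hN).trans_lt (hx i j hj)⟩
  have hcov : S ⊆ ⋃ N, O N := by
    intro x hx
    have hev : ∀ᶠ N : ℕ in Filter.atTop, ∀ i j, 0 < g i j x → 1 / ((N : ℝ) + 1) < g i j x := by
      refine Filter.eventually_all.2 fun i => Filter.eventually_all.2 fun j => ?_
      by_cases h0 : 0 < g i j x
      · filter_upwards [tendsto_one_div_add_atTop_nhds_zero_nat.eventually (gt_mem_nhds h0)] with
          N hN _ using hN
      · simp [h0]
    obtain ⟨N, hN⟩ := hev.exists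
    simp only [O, mem_iUnion, mem_iInter, mem_ofPred_eq, exists_prop]
    exact ⟨N, fun i => Finset.univ.filter fun j => 0 < g i j x, h x hx,
      fun i j hj => hN i j (Finset.mem_filter.1 hj).2⟩
  obtain ⟨N, hN⟩ := hS.elim_directed_cover O hO hcov
    (fun N N' => ⟨max N N', hmono _ _ (le_max_left _ _), hmono _ _ (le_max_right _ _)⟩)
  refine ⟨1 / ((N : ℝ) + 1), by positivity, fun x hx => ?_⟩
  have := hN hx
  simp only [O, mem_iUnion, mem_iInter, mem_ofPred_eq, exists_prop] at this
  obtain ⟨X, hX, hx⟩ := this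
  refine hX.trans (Finset.sum_le_sum fun i _ => Nat.sub_le_sub_right (Finset.card_le_card ?_) 1)
  exact fun j hj => Finset.mem_filter.2 ⟨Finset.mem_univ _, hx i j hj⟩

/-- Two disjoint subsets of a set cannot both have many excess elements. -/
theorem card_sub_one_add_le {α : Type*} [DecidableEq α] {X Y R : Finset α} (hX : X ⊆ R)
    (hY : Y ⊆ R) (hXY : Disjoint X Y) : (X.card - 1) + (Y.card - 1) ≤ R.card - 1 := by
  have := Finset.card_le_card (Finset.union_subset hX hY)
  rw [Finset.card_union_of_disjoint hXY] at this
  omega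

/-- The topological obstruction: a space of linear dependencies in which every nonzero vector has
a positive part of large weight cannot have large dimension. -/
theorem finrank_le_of_weight {r : ℕ} {n : Fin r → ℕ} {U : Type*} [AddCommGroup U] [Module ℝ U]
    [FiniteDimensional ℝ U] (g : ∀ i, Fin (n i + 1) → U →ₗ[ℝ] ℝ) {K : ℕ}
    (hg : ∀ u : U, u ≠ 0 → K + 1 ≤ ∑ i, ((Finset.univ.filter fun j => 0 < g i j u).card - 1))
    {A B : Finset (Fin r)} (hdisj : Disjoint A B) (hunion : A ∪ B = Finset.univ)
    (R : ∀ i, Finset (Fin (n i + 1))) (a : Fin r → ℕ) (b : ℕ)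
    (hA : ∀ i ∈ A, (R i).card ≤ 2 * a i + 3) (hB : ∑ i ∈ B, ((R i).card - 1) ≤ 2 * b + 1)
    (hK : ∑ i ∈ A, a i + b ≤ K) :
    Module.finrank ℝ U ≤
      ∑ i, (n i + 1 - (R i).card) + A.card + (if B.Nonempty then 1 else 0) - 1 := by
  classical
  let m := Module.finrank ℝ U
  let φ : (Fin m → ℝ) ≃ₗ[ℝ] U := (Module.finBasis ℝ U).equivFun.symm
  let G : ∀ i, Fin (n i + 1) → (Fin m → ℝ) →ₗ[ℝ] ℝ := fun i j => g i j ∘ₗ φ.toLinearMap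
  have hGc : ∀ i j, Continuous (G i j) := fun i j => LinearMap.continuous_of_finiteDimensional _
  obtain ⟨δ, hδ, hcovδ⟩ := exists_pos_threshold (fun i j x => G i j x) hGc
    (isCompact_crossSphere m m) fun x hx => hg (φ x) (by simpa using ne_zero_of_mem_crossSphere hx)
  have hunif : ∃ ε > 0, ∀ x y, dist x y ≤ ε → ∀ i j, |G i j x - G i j y| < 2 * δ := by
    have h1 : ∀ i j, UniformContinuous (G i j) := fun i j =>
      ((G i j).toContinuousLinearMap).uniformContinuous
    have h2 : ∀ᶠ q in uniformity (Fin m → ℝ), ∀ i j, dist (G i j q.1) (G i j q.2) < 2 * δ :=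
      Filter.eventually_all.2 fun i => Filter.eventually_all.2 fun j =>
        (h1 i j) (Metric.dist_mem_uniformity (by positivity))
    obtain ⟨ε, hε, h⟩ := Metric.mem_uniformity_dist.1 h2
    exact ⟨ε / 2, by positivity, fun x y hxy i j => h (hxy.trans_lt (half_lt_self hε)) i j⟩
  obtain ⟨ε, hε, hunif⟩ := hunif
  let P : (Fin m → ℝ) → ∀ i, Finset (Fin (n i + 1)) := fun x i =>
    Finset.univ.filter fun j => δ < G i j x
  have hPdisj : ∀ x y, dist x y ≤ ε → ∀ i, Disjoint (P x i) (P (-y) i) := by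
    intro x y hxy i
    rw [Finset.disjoint_left]
    intro j hj hj'
    have h1 : δ < G i j x := (Finset.mem_filter.1 hj).2
    have h2 : δ < G i j (-y) := (Finset.mem_filter.1 hj').2
    rw [map_neg] at h2
    have := (abs_lt.1 (hunif x y hxy i j)).2
    linarith
  let C := (Σ i, {j // j ∉ R i}) ⊕ ({i // i ∈ A} ⊕ {_x : Unit // B.Nonempty})
  let p : C → (Fin m → ℝ) → Prop := fun c x => match c with
    | Sum.inl e => e.2.1 ∈ P x e.1
    | Sum.inr (Sum.inl i) => a i + 1 ≤ (P x i ∩ R i).card - 1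
    | Sum.inr (Sum.inr _) => b + 1 ≤ ∑ i ∈ B, ((P x i ∩ R i).card - 1)
  have hcard : Fintype.card C =
      ∑ i, (n i + 1 - (R i).card) + A.card + (if B.Nonempty then 1 else 0) := by
    have h1 : ∀ i, Fintype.card {j // j ∉ R i} = n i + 1 - (R i).card := by
      intro i
      rw [Fintype.card_subtype_compl]
      simp
    have h2 : Fintype.card {_x : Unit // B.Nonempty} = if B.Nonempty then 1 else 0 := by
      split_ifs with h <;> simp [h]
    simp only [C, Fintype.card_sum, Fintype.card_sigma, h1, h2, Fintype.card_coe, add_assoc]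
  rw [← hcard]
  refine le_card_sub_one_of_antipodal_cover p (fun x hx => ?_) hε ?_
  · by_contra! hno
    have hPR : ∀ i, P x i ∩ R i = P x i := fun i => Finset.inter_eq_left.2 fun j hj => by
      by_contra hjR
      exact hno (Sum.inl ⟨i, ⟨j, hjR⟩⟩) hj
    have h1 : ∑ i ∈ A, ((P x i).card - 1) ≤ ∑ i ∈ A, a i := Finset.sum_le_sum fun i hi => by
      have := hno (Sum.inr (Sum.inl ⟨i, hi⟩))
      simp only [p, hPR] at this
      omega
    have h2 : ∑ i ∈ B, ((P x i).card - 1) ≤ b := by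
      rcases B.eq_empty_or_nonempty with h | h
      · simp [h]
      · have := hno (Sum.inr (Sum.inr ⟨(), h⟩))
        simp only [p, hPR] at this
        omega
    have h3 : K + 1 ≤ ∑ i, ((P x i).card - 1) := hcovδ x hx
    rw [← hunion, Finset.sum_union hdisj] at h3
    omega
  · rintro x - y - hxy (⟨i, j, hj⟩ | ⟨i, hi⟩ | _) h1 h2
    · exact Finset.disjoint_left.1 (hPdisj x y hxy i) h1 h2
    · have hd : Disjoint (P x i ∩ R i) (P (-y) i ∩ R i) :=
        (hPdisj x y hxy i).mono Finset.inter_subset_left Finset.inter_subset_left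
      have := Finset.card_le_card (Finset.union_subset (Finset.inter_subset_right (s₁ := P x i))
        (Finset.inter_subset_right (s₁ := P (-y) i) (s₂ := R i)))
      rw [Finset.card_union_of_disjoint hd] at this
      have := hA i hi
      simp only [p] at h1 h2
      omega
    · have : ∑ i ∈ B, ((P x i ∩ R i).card - 1) + ∑ i ∈ B, ((P (-y) i ∩ R i).card - 1) ≤
          ∑ i ∈ B, ((R i).card - 1) := by
        rw [← Finset.sum_add_distrib]
        exact Finset.sum_le_sum fun i _ => card_sub_one_add_le Finset.inter_subset_right
          Finset.inter_subset_right
          ((hPdisj x y hxy i).mono Finset.inter_subset_left Finset.inter_subset_left)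
      simp only [p] at h1 h2
      omega

/-- Below any bounded function one finds functions of every smaller sum. -/
theorem exists_le_sum_eq {ι : Type*} (s : Finset ι) (u : ι → ℕ) {t : ℕ} (ht : t ≤ ∑ i ∈ s, u i) :
    ∃ a : ι → ℕ, (∀ i, a i ≤ u i) ∧ ∑ i ∈ s, a i = t := by
  classical
  induction s using Finset.induction_on generalizing t with
  | empty => exact ⟨0, fun _ => Nat.zero_le _, by simpa using ht.antisymm (Nat.zero_le _) |>.symm⟩
  | insert j s hj ih =>
    rw [Finset.sum_insert hj] at ht
    obtain ⟨a, ha, hs⟩ := ih (t := t - min t (u j)) (by omega)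
    refine ⟨Function.update a j (min t (u j)), fun i => ?_, ?_⟩
    · by_cases h : i = j
      · subst h
        simp
      · simp [h, ha i]
    · rw [Finset.sum_insert hj, Function.update_self, Finset.sum_congr rfl fun i hi =>
        Function.update_of_ne (ne_of_mem_of_not_mem hi hj) _ _, hs]
      omega
/-- The poset of nonempty faces of a product of simplices, encoded by the vertex sets of the
factors. -/
abbrev Box {r : ℕ} (n : Fin r → ℕ) :=
  {σ : ∀ i, Finset (Fin (n i + 1)) // ∀ i, (σ i).Nonempty}

/-- The dimension of the face of a product of simplices encoded by a box. -/
def boxDim {r : ℕ} {n : Fin r → ℕ} (σ : Box n) : ℕ := ∑ i, ((σ.1 i).card - 1)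

/-- The face of a product of simplices encoded by a box. -/
def boxFace {r : ℕ} {n : Fin r → ℕ} (σ : Box n) : Set (∀ i, Fin (n i + 1) → ℝ) :=
  {x ∈ prodSimplex n | ∀ i, ∀ j ∉ σ.1 i, x i j = 0}

section ProdSimplex

variable {r : ℕ} {n : Fin r → ℕ}

theorem single_mem_boxFace {σ : Box n} {v : ∀ i, Fin (n i + 1)} (hv : ∀ i, v i ∈ σ.1 i) :
    (fun i => Pi.single (v i) 1 : ∀ i, Fin (n i + 1) → ℝ) ∈ boxFace σ := by
  refine ⟨fun i _ => single_mem_stdSimplex ℝ (v i), fun i j hj => ?_⟩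
  exact Pi.single_eq_of_ne (fun h : j = v i => hj (by rw [h]; exact hv i)) _

theorem isFace_boxFace (σ : Box n) : IsFace (prodSimplex n) (boxFace σ) := by
  classical
  choose v hv using σ.2
  refine ⟨⟨_, single_mem_boxFace hv⟩,
    -∑ i, ∑ j ∈ (σ.1 i)ᶜ, (LinearMap.proj j ∘ₗ LinearMap.proj i), ?_⟩
  have key (x : ∀ i, Fin (n i + 1) → ℝ) :
      (-∑ i, ∑ j ∈ (σ.1 i)ᶜ, (LinearMap.proj j ∘ₗ LinearMap.proj i :
        (∀ i, Fin (n i + 1) → ℝ) →ₗ[ℝ] ℝ)) x = -∑ i, ∑ j ∈ (σ.1 i)ᶜ, x i j := by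
    simp [LinearMap.sum_apply]
  have hpos (x) (hx : x ∈ prodSimplex n) : 0 ≤ ∑ i, ∑ j ∈ (σ.1 i)ᶜ, x i j :=
    Finset.sum_nonneg fun i _ => Finset.sum_nonneg fun j _ => (hx i (mem_univ i)).1 j
  have hzero (x) (hx : x ∈ boxFace σ) : ∑ i, ∑ j ∈ (σ.1 i)ᶜ, x i j = 0 :=
    Finset.sum_eq_zero fun i _ => Finset.sum_eq_zero fun j hj =>
      hx.2 i j (Finset.mem_compl.1 hj)
  ext x
  constructor
  · intro hx
    refine ⟨hx.1, fun y hy => ?_⟩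
    rw [key, key, hzero x hx]
    linarith [hpos y hy]
  · rintro ⟨hx, hmax⟩
    refine ⟨hx, fun i j hj => ?_⟩
    have h1 := hmax _ (single_mem_boxFace hv).1
    rw [key, key, hzero _ (single_mem_boxFace hv)] at h1
    have h2 : ∑ i, ∑ j ∈ (σ.1 i)ᶜ, x i j = 0 := le_antisymm (by linarith) (hpos x hx)
    rw [Finset.sum_eq_zero_iff_of_nonneg (fun i _ => Finset.sum_nonneg fun j _ =>
      (hx i (mem_univ i)).1 j)] at h2
    have h3 := h2 i (Finset.mem_univ i)
    rw [Finset.sum_eq_zero_iff_of_nonneg (fun j _ => (hx i (mem_univ i)).1 j)] at h3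
    exact h3 j (Finset.mem_compl.2 hj)

theorem boxFace_subset_iff {σ τ : Box n} : boxFace σ ⊆ boxFace τ ↔ σ ≤ τ := by
  classical
  constructor
  · intro h i j hj
    choose v hv using σ.2
    by_contra hτ
    have hw : ∀ i', Function.update v i j i' ∈ σ.1 i' := by
      intro i'
      by_cases hi : i' = i
      · subst hi; simpa using hj
      · simpa [hi] using hv i'
    have := (h (single_mem_boxFace hw)).2 i j hτ
    simp at this
  · intro h x hx
    exact ⟨hx.1, fun i j hj => hx.2 i j fun h' => hj (h i h')⟩

theorem exists_boxFace_eq {F : Set (∀ i, Fin (n i + 1) → ℝ)} (hF : IsFace (prodSimplex n) F) :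
    ∃ σ : Box n, boxFace σ = F := by
  classical
  obtain ⟨-, c, rfl⟩ := hF
  set g : ∀ i, Fin (n i + 1) → ℝ := fun i j => c (Pi.single i (Pi.single j 1)) with hg
  have hc (x) : c x = ∑ i, ∑ j, x i j * g i j := by
    conv_lhs => rw [← Finset.univ_sum_single x]
    rw [map_sum]
    refine Finset.sum_congr rfl fun i _ => ?_
    have : (Pi.single i (x i) : ∀ i, Fin (n i + 1) → ℝ)
        = ∑ j, x i j • Pi.single i (Pi.single j (1 : ℝ)) := by
      have h := Finset.univ_sum_single (x i)
      conv_lhs => rw [← h]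
      rw [← LinearMap.single_apply (R := ℝ), map_sum]
      refine Finset.sum_congr rfl fun j _ => ?_
      rw [LinearMap.single_apply, ← Pi.single_smul, ← Pi.single_smul, smul_eq_mul, mul_one]
    rw [this, map_sum]
    simp [hg]
  have hm (i) : ∃ j, ∀ j', g i j' ≤ g i j := Finite.exists_max (g i)
  choose m hm using hm
  have hsum (x) (hx : x ∈ prodSimplex n) :
      ∑ i, ∑ j, x i j * (g i (m i) - g i j) = ∑ i, g i (m i) - c x := by
    rw [hc, ← Finset.sum_sub_distrib]
    refine Finset.sum_congr rfl fun i _ => ?_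
    simp_rw [mul_sub]
    rw [Finset.sum_sub_distrib, ← Finset.sum_mul, (hx i (mem_univ i)).2, one_mul]
  have hterm (x) (hx : x ∈ prodSimplex n) (i j) : 0 ≤ x i j * (g i (m i) - g i j) :=
    mul_nonneg ((hx i (mem_univ i)).1 j) (sub_nonneg.2 (hm i j))
  let σ : Box n := ⟨fun i => Finset.univ.filter fun j => g i (m i) ≤ g i j,
    fun i => ⟨m i, by simp⟩⟩
  have hσ (x) (hx : x ∈ boxFace σ) : c x = ∑ i, g i (m i) := by
    have h := hsum x hx.1
    rw [Finset.sum_eq_zero] at h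
    · linarith
    intro i _
    refine Finset.sum_eq_zero fun j _ => ?_
    by_cases hj : g i (m i) ≤ g i j
    · rw [le_antisymm hj (hm i j), sub_self, mul_zero]
    · rw [hx.2 i j (by simpa [σ] using hj), zero_mul]
  refine ⟨σ, ?_⟩
  ext x
  constructor
  · intro hx
    refine ⟨hx.1, fun y hy => ?_⟩
    rw [hσ x hx]
    have h := hsum y hy
    have := Finset.sum_nonneg fun i (_ : i ∈ Finset.univ) =>
      Finset.sum_nonneg fun j (_ : j ∈ Finset.univ) => hterm y hy i j
    linarith
  · rintro ⟨hx, hmax⟩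
    refine ⟨hx, fun i j hj => ?_⟩
    have hmσ : ∀ i, m i ∈ σ.1 i := fun i => by simp [σ]
    have h1 := hmax _ (single_mem_boxFace hmσ).1
    rw [hσ _ (single_mem_boxFace hmσ)] at h1
    have h0 := Finset.sum_nonneg fun i (_ : i ∈ Finset.univ) =>
      Finset.sum_nonneg fun j (_ : j ∈ Finset.univ) => hterm x hx i j
    have h2 := le_antisymm (by rw [hsum x hx]; linarith) h0
    rw [Finset.sum_eq_zero_iff_of_nonneg (fun i _ => Finset.sum_nonneg fun j _ =>
      hterm x hx i j)] at h2
    have h3 := h2 i (Finset.mem_univ i)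
    rw [Finset.sum_eq_zero_iff_of_nonneg (fun j _ => hterm x hx i j)] at h3
    rcases mul_eq_zero.1 (h3 j (Finset.mem_univ j)) with h | h
    · exact h
    · exact absurd (by simp only [σ, Finset.mem_filter_univ]; linarith) hj

/-- The face poset of a product of simplices is the poset of boxes. -/
noncomputable def boxEquiv (n : Fin r → ℕ) : Box n ≃o facesOf (prodSimplex n) :=
  RelIso.ofSurjective
    (OrderEmbedding.ofMapLEIff (fun σ => ⟨boxFace σ, isFace_boxFace σ⟩ : Box n → _)
      fun _ _ => boxFace_subset_iff)
    fun F => by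
      obtain ⟨σ, hσ⟩ := exists_boxFace_eq F.2
      exact ⟨σ, Subtype.ext hσ⟩

theorem polyDim_boxFace_le (σ : Box n) : polyDim (boxFace σ) ≤ boxDim σ := by
  classical
  choose v hv using σ.2
  let D : Submodule ℝ (∀ i, Fin (n i + 1) → ℝ) :=
    { carrier := {w | ∀ i, ∑ j, w i j = 0 ∧ ∀ j ∉ σ.1 i, w i j = 0}
      add_mem' := by
        intro a b ha hb i
        refine ⟨?_, fun j hj => ?_⟩
        · simp [Finset.sum_add_distrib, (ha i).1, (hb i).1]
        · simp [(ha i).2 j hj, (hb i).2 j hj]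
      zero_mem' := by intro i; simp
      smul_mem' := by
        intro c a ha i
        refine ⟨?_, fun j hj => ?_⟩
        · simp [← Finset.mul_sum, (ha i).1]
        · simp [(ha i).2 j hj] }
  have hD : (affineSpan ℝ (boxFace σ)).direction ≤ D := by
    rw [direction_affineSpan, vectorSpan_def, Submodule.span_le]
    rintro _ ⟨x, hx, y, hy, rfl⟩ i
    refine ⟨?_, fun j hj => ?_⟩
    · simp [(hx.1 i (mem_univ i)).2, (hy.1 i (mem_univ i)).2]
    · simp [hx.2 i j hj, hy.2 i j hj]
  let L : (∀ i, Fin (n i + 1) → ℝ) →ₗ[ℝ] (∀ i, ((σ.1 i).erase (v i) : Finset _) → ℝ) :=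
    LinearMap.pi fun i => LinearMap.pi fun j => LinearMap.proj j.1 ∘ₗ LinearMap.proj i
  have hL : Function.Injective (L ∘ₗ D.subtype) := by
    rw [← LinearMap.ker_eq_bot, LinearMap.ker_eq_bot']
    rintro ⟨w, hw⟩ h
    have h0 (i j) (hj : j ≠ v i) : w i j = 0 := by
      by_cases hjσ : j ∈ σ.1 i
      · exact congrFun (congrFun h i) ⟨j, Finset.mem_erase.2 ⟨hj, hjσ⟩⟩
      · exact (hw i).2 j hjσ
    ext i j
    by_cases hj : j = v i
    · subst hj
      have := (hw i).1
      rwa [Finset.sum_eq_single (v i) (fun j _ hj => h0 i j hj) (by simp)] at this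
    · exact h0 i j hj
  calc polyDim (boxFace σ) ≤ Module.finrank ℝ D := Submodule.finrank_mono hD
    _ ≤ _ := LinearMap.finrank_le_finrank_of_injective hL
    _ = boxDim σ := by
      rw [Module.finrank_pi_fintype, boxDim]
      refine Finset.sum_congr rfl fun i _ => ?_
      rw [Module.finrank_fintype_fun_eq_card, Fintype.card_coe, Finset.card_erase_of_mem (hv i)]

end ProdSimplex

section Combinatorics

variable {r : ℕ} {n : Fin r → ℕ}

/-- The box with a single vertex. -/
def vertexBox (v : ∀ i, Fin (n i + 1)) : Box n :=
  ⟨fun i => {v i}, fun _ => Finset.singleton_nonempty _⟩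

theorem vertexBox_le_iff {v : ∀ i, Fin (n i + 1)} {σ : Box n} :
    vertexBox v ≤ σ ↔ ∀ i, v i ∈ σ.1 i :=
  forall_congr' fun _ => Finset.singleton_subset_iff

theorem boxDim_vertexBox (v : ∀ i, Fin (n i + 1)) : boxDim (vertexBox v) = 0 := by
  simp [boxDim, vertexBox]

theorem vertexBox_injective : Function.Injective (vertexBox (n := n)) := fun _ _ h =>
  funext fun i => Finset.mem_singleton.1 (vertexBox_le_iff.1 h.le i)

theorem le_iff_vertexBox {σ τ : Box n} : σ ≤ τ ↔ ∀ v, vertexBox v ≤ σ → vertexBox v ≤ τ := by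
  refine ⟨fun h v hv => hv.trans h, fun h i j hj => ?_⟩
  classical
  choose v hv using σ.2
  have := vertexBox_le_iff.1 (h (Function.update v i j) (vertexBox_le_iff.2 fun i' => ?_)) i
  · simpa using this
  · by_cases hi : i' = i
    · subst hi; simpa using hj
    · simpa [hi] using hv i'

theorem eq_vertexBox_of_boxDim_eq_zero {σ : Box n} (h : boxDim σ = 0) : ∃ v, σ = vertexBox v := by
  have h1 (i) : ∃ a, σ.1 i = {a} := by
    have := (Finset.sum_eq_zero_iff.1 h) i (Finset.mem_univ i)
    have h2 := (σ.2 i).card_pos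
    exact Finset.card_eq_one.1 (by omega)
  choose v hv using h1
  exact ⟨v, Subtype.ext (funext hv)⟩

/-- Two vertices of a product of simplices are adjacent if they differ in one coordinate. -/
def VertexAdj (v w : ∀ i, Fin (n i + 1)) : Prop := ∃ i, v i ≠ w i ∧ ∀ j ≠ i, v j = w j

open Classical in
theorem card_adj_in_box {v : ∀ i, Fin (n i + 1)} {σ : Box n} (hv : vertexBox v ≤ σ) :
    (Finset.univ.filter fun w => vertexBox w ≤ σ ∧ VertexAdj v w).card = boxDim σ := by
  rw [vertexBox_le_iff] at hv
  have h : boxDim σ = (Finset.univ.sigma fun i => (σ.1 i).erase (v i)).card := by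
    rw [Finset.card_sigma]
    exact Finset.sum_congr rfl fun i _ => (Finset.card_erase_of_mem (hv i)).symm
  rw [h]
  symm
  refine Finset.card_bij (fun p _ => Function.update v p.1 p.2) ?_ ?_ ?_
  · rintro ⟨i, a⟩ hp
    simp only [Finset.mem_sigma, Finset.mem_univ, Finset.mem_erase, true_and] at hp
    simp only [Finset.mem_filter_univ, vertexBox_le_iff]
    refine ⟨fun j => ?_, i, by simpa using hp.1.symm, fun j hj => by simp [hj]⟩
    by_cases hj : j = i
    · subst hj; simpa using hp.2
    · simpa [hj] using hv j
  · rintro ⟨i, a⟩ hp ⟨j, b⟩ hq he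
    simp only [Finset.mem_sigma, Finset.mem_univ, Finset.mem_erase, true_and] at hp hq
    by_cases hij : i = j
    · subst hij
      have := congrFun he i
      simp only [Function.update_self] at this
      rw [this]
    · have := congrFun he i
      simp only [Function.update_self, Function.update_of_ne hij] at this
      exact absurd this hp.1
  · intro w hw
    simp only [Finset.mem_filter_univ, vertexBox_le_iff] at hw
    obtain ⟨hw, i, hi, hne⟩ := hw
    refine ⟨⟨i, w i⟩, ?_, ?_⟩
    · simpa using ⟨hi.symm, hw i⟩
    · funext j
      by_cases hj : j = i
      · subst hj; simp
      · simp [hj, hne j hj]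

theorem exists_edge_box {v w : ∀ i, Fin (n i + 1)} (h : VertexAdj v w) :
    ∃ e : Box n, boxDim e = 1 ∧ ∀ u, vertexBox u ≤ e ↔ u = v ∨ u = w := by
  classical
  obtain ⟨i, hi, hne⟩ := h
  refine ⟨⟨fun j => {v j, w j}, fun j => Finset.insert_nonempty _ _⟩, ?_, fun u => ?_⟩
  · rw [boxDim, Finset.sum_eq_single i]
    · simp [Finset.card_pair hi]
    · intro j _ hj
      simp [hne j hj]
    · simp
  · rw [vertexBox_le_iff]
    simp only [Finset.mem_insert, Finset.mem_singleton]
    constructor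
    · intro hu
      have hj (j) (hj : j ≠ i) : u j = v j ∧ u j = w j := by
        have := hu j
        rw [← hne j hj, or_self] at this
        exact ⟨this, this.trans (hne j hj)⟩
      refine (hu i).imp (fun h => ?_) (fun h => ?_) <;> funext j <;>
        by_cases hji : j = i
      · rw [hji, h]
      · exact (hj j hji).1
      · rw [hji, h]
      · exact (hj j hji).2
    · rintro (rfl | rfl) j <;> simp

theorem vertexAdj_of_box {v w : ∀ i, Fin (n i + 1)} (hvw : v ≠ w) {e : Box n}
    (he : ∀ u, vertexBox u ≤ e ↔ u = v ∨ u = w) : VertexAdj v w := by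
  classical
  obtain ⟨i, hi⟩ := Function.ne_iff.1 hvw
  have hv := vertexBox_le_iff.1 ((he v).2 (Or.inl rfl))
  have hw := vertexBox_le_iff.1 ((he w).2 (Or.inr rfl))
  refine ⟨i, hi, fun j hj => ?_⟩
  have hu : vertexBox (Function.update v i (w i)) ≤ e := by
    rw [vertexBox_le_iff]
    intro j
    by_cases hj : j = i
    · subst hj; simpa using hw j
    · simpa [hj] using hv j
  rcases (he _).1 hu with h | h
  · exact absurd (by simpa using congrFun h i) (Ne.symm hi)
  · simpa [hj] using congrFun h j

/-- An order embedding of the `k`-skeleton of a product of simplices into its face poset, sending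
distinct vertices to disjoint faces, has the `k`-skeleton as its range. -/
theorem exists_eq_of_embedding {k : ℕ} (φ : {σ : Box n // boxDim σ ≤ k} → Box n)
    (hφ : ∀ σ τ, φ σ ≤ φ τ ↔ σ ≤ τ)
    (hdisj : ∀ σ τ, boxDim σ.1 = 0 → boxDim τ.1 = 0 → ∀ μ, μ ≤ φ σ → μ ≤ φ τ → σ = τ)
    {ρ : Box n} (hρ : boxDim ρ ≤ k) : ∃ σ, φ σ = ρ := by
  classical
  let vb (v : ∀ i, Fin (n i + 1)) : {σ : Box n // boxDim σ ≤ k} :=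
    ⟨vertexBox v, (boxDim_vertexBox v).trans_le k.zero_le⟩
  have hvb (v w) (μ) (h1 : μ ≤ φ (vb v)) (h2 : μ ≤ φ (vb w)) : v = w :=
    vertexBox_injective (congrArg Subtype.val
      (hdisj (vb v) (vb w) (boxDim_vertexBox v) (boxDim_vertexBox w) μ h1 h2))
  have hex (v) : ∃ u, vertexBox u ≤ φ (vb v) := by
    choose u hu using (φ (vb v)).2
    exact ⟨u, vertexBox_le_iff.2 hu⟩
  choose π hπ using hex
  have hinj : Function.Injective π := fun v w h => hvb v w _ (hπ v) (h ▸ hπ w)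
  have hsurj : Function.Surjective π := Finite.injective_iff_surjective.1 hinj
  have hφv (v) : φ (vb v) = vertexBox (π v) := by
    refine le_antisymm (le_iff_vertexBox.2 fun u hu => ?_) (hπ v)
    obtain ⟨w, rfl⟩ := hsurj u
    rw [hvb v w _ hu (hπ w)]
  have hmem (σ : {σ : Box n // boxDim σ ≤ k}) (v) : vertexBox (π v) ≤ φ σ ↔ vertexBox v ≤ σ.1 := by
    rw [← hφv, hφ]
    rfl
  have hdim (σ) : boxDim (φ σ) ≤ k := by
    obtain ⟨σ, hσ⟩ := σ
    rcases Nat.eq_zero_or_pos k with rfl | hk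
    · obtain ⟨v, rfl⟩ := eq_vertexBox_of_boxDim_eq_zero (Nat.le_zero.1 hσ)
      exact (congrArg boxDim (hφv v)).trans_le (boxDim_vertexBox _).le
    have hadj (v w) (h : VertexAdj v w) : VertexAdj (π v) (π w) := by
      obtain ⟨e, he1, he⟩ := exists_edge_box h
      have hne : v ≠ w := by
        rintro rfl
        obtain ⟨i, hi, -⟩ := h
        exact hi rfl
      refine vertexAdj_of_box (hinj.ne hne) (e := φ ⟨e, he1.trans_le hk⟩) fun u => ?_
      obtain ⟨u, rfl⟩ := hsurj u
      rw [hmem, he, hinj.eq_iff, hinj.eq_iff]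
    let T : {p : (∀ i, Fin (n i + 1)) × (∀ i, Fin (n i + 1)) // VertexAdj p.1 p.2} →
        {p : (∀ i, Fin (n i + 1)) × (∀ i, Fin (n i + 1)) // VertexAdj p.1 p.2} :=
      fun p => ⟨(π p.1.1, π p.1.2), hadj _ _ p.2⟩
    have hT : Function.Injective T := by
      rintro ⟨⟨a, b⟩, hab⟩ ⟨⟨c, d⟩, hcd⟩ h
      have h' := congrArg Subtype.val h
      simp only [T, Prod.mk.injEq] at h'
      simp only [Subtype.mk.injEq, Prod.mk.injEq]
      exact ⟨hinj h'.1, hinj h'.2⟩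
    have hadj' (v w) : VertexAdj (π v) (π w) ↔ VertexAdj v w := by
      refine ⟨fun h => ?_, hadj v w⟩
      obtain ⟨⟨⟨a, b⟩, hab⟩, hp⟩ := Finite.injective_iff_surjective.1 hT ⟨(π v, π w), h⟩
      have h' := congrArg Subtype.val hp
      simp only [T, Prod.mk.injEq] at h'
      rwa [hinj h'.1, hinj h'.2] at hab
    choose v hv using σ.2
    have hv' : vertexBox v ≤ σ := vertexBox_le_iff.2 hv
    rw [← card_adj_in_box ((hmem ⟨σ, hσ⟩ v).2 hv')]
    refine le_trans (le_of_eq ?_) ((card_adj_in_box hv').trans_le hσ)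
    symm
    refine Finset.card_bij (fun w _ => π w) (fun w hw => ?_) (fun _ _ _ _ h => hinj h)
      fun u hu => ?_
    · simpa [hmem, hadj'] using hw
    · obtain ⟨w, rfl⟩ := hsurj u
      exact ⟨w, by simpa [hmem, hadj'] using hu, rfl⟩
  let Φ : {σ : Box n // boxDim σ ≤ k} → {σ : Box n // boxDim σ ≤ k} := fun σ => ⟨φ σ, hdim σ⟩
  have hΦ : Function.Injective Φ := by
    intro σ τ h
    have h' : φ σ = φ τ := congrArg Subtype.val h
    exact le_antisymm ((hφ _ _).1 h'.le) ((hφ _ _).1 h'.ge)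
  obtain ⟨σ, hσ⟩ := Finite.injective_iff_surjective.1 hΦ ⟨ρ, hρ⟩
  exact ⟨σ, congrArg Subtype.val hσ⟩

end Combinatorics

section Faces

variable {V : Type*} [AddCommGroup V] [Module ℝ V] {E : Type*} [AddCommGroup E] [Module ℝ E]
  {Q F F' : Set V}

theorem IsFace.subset (h : IsFace Q F) : F ⊆ Q := by
  obtain ⟨-, c, rfl⟩ := h
  exact fun x hx => hx.1

/-- A nonempty face of `Q` is where some functional attains an upper bound of its values on `Q`. -/
theorem IsFace.exists_functional (h : IsFace Q F) :
    ∃ (c : V →ₗ[ℝ] ℝ) (M : ℝ), (∀ x ∈ Q, c x ≤ M) ∧ ∀ x, x ∈ F ↔ x ∈ Q ∧ c x = M := by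
  obtain ⟨⟨a, ha⟩, c, rfl⟩ := h
  exact ⟨c, c a, ha.2, fun x => ⟨fun hx => ⟨hx.1, le_antisymm (ha.2 x hx.1) (hx.2 a ha.1)⟩,
    fun hx => ⟨hx.1, fun y hy => (ha.2 y hy).trans hx.2.ge⟩⟩⟩

/-- A nonempty intersection of supporting hyperplanes of `Q` with `Q` is a face. -/
theorem isFace_of_supporting {ι : Type*} (T : Finset ι) (c : ι → V →ₗ[ℝ] ℝ) (M : ι → ℝ)
    (hM : ∀ e, ∀ x ∈ Q, c e x ≤ M e) (hne : {x ∈ Q | ∀ e ∈ T, c e x = M e}.Nonempty) :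
    IsFace Q {x ∈ Q | ∀ e ∈ T, c e x = M e} := by
  refine ⟨hne, ∑ e ∈ T, c e, ?_⟩
  obtain ⟨a, ha, haM⟩ := hne
  ext x
  simp only [mem_ofPred_eq, LinearMap.sum_apply]
  refine and_congr_right fun hx => ⟨fun h y hy => Finset.sum_le_sum fun e he =>
    (hM e y hy).trans (h e he).ge, fun h => ?_⟩
  have h1 : ∑ e ∈ T, (M e - c e x) ≤ 0 := by
    have := h a ha
    rw [Finset.sum_congr rfl haM] at this
    rw [Finset.sum_sub_distrib]
    linarith
  have h0 : ∀ e ∈ T, 0 ≤ M e - c e x := fun e _ => sub_nonneg.2 (hM e x hx)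
  have h2 := (Finset.sum_eq_zero_iff_of_nonneg h0).1 (le_antisymm h1 (Finset.sum_nonneg h0))
  exact fun e he => (sub_eq_zero.1 (h2 e he)).symm

theorem IsFace.inter (h : IsFace Q F) (h' : IsFace Q F') (hne : (F ∩ F').Nonempty) :
    IsFace Q (F ∩ F') := by
  obtain ⟨c, M, hM, hF⟩ := h.exists_functional
  obtain ⟨c', M', hM', hF'⟩ := h'.exists_functional
  have heq : F ∩ F' = {x ∈ Q | ∀ e ∈ (Finset.univ : Finset Bool),
      (bif e then c else c') x = bif e then M else M'} := by
    ext x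
    simp only [mem_inter_iff, hF, hF', mem_ofPred_eq, Finset.mem_univ, true_imp_iff,
      Bool.forall_bool, cond_true, cond_false]
    tauto
  rw [heq] at hne ⊢
  refine isFace_of_supporting (ι := Bool) Finset.univ _ _ (fun e x hx => ?_) hne
  cases e
  · exact hM' x hx
  · exact hM x hx

theorem IsFace.preimage {f : V →ₗ[ℝ] E} {F : Set E} (h : IsFace (f '' Q) F) :
    IsFace Q (Q ∩ f ⁻¹' F) := by
  obtain ⟨⟨a, ha⟩, c, rfl⟩ := h
  obtain ⟨q, hq, rfl⟩ := ha.1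
  refine ⟨⟨q, hq, ha⟩, c ∘ₗ f, ?_⟩
  ext x
  constructor
  · exact fun hx => ⟨hx.1, fun y hy => hx.2.2 _ (mem_image_of_mem f hy)⟩
  · rintro ⟨hx, hx'⟩
    refine ⟨hx, mem_image_of_mem f hx, ?_⟩
    rintro _ ⟨y, hy, rfl⟩
    exact hx' y hy

theorem polyDim_mono [FiniteDimensional ℝ V] (h : F ⊆ F') : polyDim F ≤ polyDim F' :=
  Submodule.finrank_mono (AffineSubspace.direction_le (affineSpan_mono ℝ h))

theorem polyDim_lt_of_ssubset [FiniteDimensional ℝ V] (hF : IsFace Q F) (hF' : F' ⊆ Q)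
    (h : F ⊂ F') : polyDim F < polyDim F' := by
  obtain ⟨c, M, hM, hc⟩ := hF.exists_functional
  obtain ⟨x, hx⟩ := hF.1
  obtain ⟨y, hy, hyF⟩ := exists_of_ssubset h
  refine Submodule.finrank_lt_finrank_of_lt (lt_of_le_of_ne
    (AffineSubspace.direction_le (affineSpan_mono ℝ h.1)) fun heq => hyF ?_)
  have h1 : (affineSpan ℝ F).direction ≤ LinearMap.ker c := by
    rw [direction_affineSpan, vectorSpan_def, Submodule.span_le]
    rintro _ ⟨a, ha, b, hb, rfl⟩
    simp [((hc a).1 ha).2, ((hc b).1 hb).2]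
  have h2 : y - x ∈ (affineSpan ℝ F').direction := by
    rw [direction_affineSpan]
    exact vsub_mem_vectorSpan ℝ hy (h.1 hx)
  have h3 := h1 (heq ▸ h2)
  rw [LinearMap.mem_ker, map_sub, sub_eq_zero, ((hc x).1 hx).2] at h3
  exact (hc y).2 ⟨hF' hy, h3⟩

/-- If `Q` has the face poset of a product of simplices and its image under `f` has the
`k`-skeleton of that product, then the faces of `Q` of dimension at most `k` are saturated with
respect to `f`. -/
theorem mem_face_of_apply_eq {r k : ℕ} {n : Fin r → ℕ} [FiniteDimensional ℝ E] {f : V →ₗ[ℝ] E}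
    (G : Box n ≃o facesOf Q) (hk : SkelEquiv k (f '' Q) (prodSimplex n)) {ρ : Box n}
    (hρ : boxDim ρ ≤ k) {x z : V} (hx : x ∈ Q) (hz : z ∈ (G ρ).1) (hxz : f x = f z) :
    x ∈ (G ρ).1 := by
  obtain ⟨ψ⟩ := hk
  let S (σ : {σ : Box n // boxDim σ ≤ k}) : skel k (prodSimplex n) :=
    ⟨boxFace σ.1, isFace_boxFace σ.1, (polyDim_boxFace_le σ.1).trans σ.2⟩
  have hS (σ) : (ψ (ψ.symm (S σ))).1 = boxFace σ.1 := by simp [S]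
  let φ (σ : {σ : Box n // boxDim σ ≤ k}) : Box n :=
    G.symm ⟨_, (ψ.symm (S σ)).2.1.preimage⟩
  have hφG (σ) : (G (φ σ)).1 = Q ∩ f ⁻¹' (ψ.symm (S σ)).1 := by simp [φ]
  have hφ (σ τ) : φ σ ≤ φ τ ↔ σ ≤ τ := by
    have h2 : (ψ.symm (S σ)).1 ⊆ (ψ.symm (S τ)).1 ↔ σ ≤ τ :=
      (ψ.symm.le_iff_le (x := S σ) (y := S τ)).trans boxFace_subset_iff
    rw [← h2, ← G.le_iff_le, ← Subtype.coe_le_coe, hφG, hφG]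
    constructor
    · intro h p hp
      obtain ⟨q, hq, rfl⟩ := (ψ.symm (S σ)).2.1.subset hp
      exact (h ⟨hq, hp⟩).2
    · exact fun h q hq => ⟨hq.1, h hq.2⟩
  have hdisj (σ τ : {σ : Box n // boxDim σ ≤ k}) (h0 : boxDim σ.1 = 0) (h0' : boxDim τ.1 = 0)
      (μ) (h : μ ≤ φ σ) (h' : μ ≤ φ τ) : σ = τ := by
    obtain ⟨q, hq⟩ := (G μ).2.1
    have h1 : q ∈ (G (φ σ)).1 := G.monotone h hq
    have h2 : q ∈ (G (φ τ)).1 := G.monotone h' hq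
    rw [hφG] at h1 h2
    have hF := (ψ.symm (S σ)).2.1.inter (ψ.symm (S τ)).2.1 ⟨f q, h1.2, h2.2⟩
    let F : skel k (f '' Q) :=
      ⟨_, hF, (polyDim_mono inter_subset_left).trans (ψ.symm (S σ)).2.2⟩
    have h3 : ψ F ≤ S σ := ψ.le_symm_apply.1 (show F.1 ⊆ _ from inter_subset_left)
    have h4 : ψ F ≤ S τ := ψ.le_symm_apply.1 (show F.1 ⊆ _ from inter_subset_right)
    obtain ⟨μ', hμ'⟩ := exists_boxFace_eq (ψ F).2.1
    rw [← Subtype.coe_le_coe, ← hμ'] at h3 h4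
    obtain ⟨v, hv⟩ := eq_vertexBox_of_boxDim_eq_zero h0
    obtain ⟨w, hw⟩ := eq_vertexBox_of_boxDim_eq_zero h0'
    have h5 := boxFace_subset_iff.1 h3
    have h6 := boxFace_subset_iff.1 h4
    rw [hv] at h5
    rw [hw] at h6
    refine Subtype.ext ?_
    rw [hv, hw]
    congr 1
    funext i
    obtain ⟨j, hj⟩ := μ'.2 i
    rw [← Finset.mem_singleton.1 (h5 i hj), ← Finset.mem_singleton.1 (h6 i hj)]
  obtain ⟨σ, hσ⟩ := exists_eq_of_embedding φ hφ hdisj hρ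
  rw [← hσ, hφG] at hz ⊢
  refine ⟨hx, ?_⟩
  rw [mem_preimage, hxz]
  exact hz.2

end Faces

section HRepresentation

variable {V : Type*} [NormedAddCommGroup V] [NormedSpace ℝ V]

/-- A convex body is cut out by the supporting half-spaces that cover its boundary. -/
theorem mem_of_forall_le_of_interior_nonempty {ι : Type*} {C : Set V} (hconv : Convex ℝ C)
    (hclosed : IsClosed C) (hint : (interior C).Nonempty) (c : ι → V →ₗ[ℝ] ℝ) (M : ι → ℝ)
    (hM : ∀ e, ∀ x ∈ C, c e x ≤ M e) (hlt : ∀ e, ∃ x ∈ C, c e x < M e)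
    (hcover : ∀ z ∈ C, ∀ l : V →ₗ[ℝ] ℝ, (∀ y ∈ C, l y ≤ l z) → (∃ y ∈ C, l y < l z) →
      ∃ e, c e z = M e) {w : V} (hw : ∀ e, c e w ≤ M e) : w ∈ C := by
  obtain ⟨y, hy⟩ := hint
  have hyC := interior_subset hy
  have hylt (e) : c e y < M e := by
    refine lt_of_le_of_ne (hM e y hyC) fun heq => ?_
    obtain ⟨x, hx, hxe⟩ := hlt e
    have hcont : Filter.Tendsto (fun t : ℝ => y + t • (y - x)) (nhdsWithin 0 (Ioi 0)) (nhds y) := by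
      have h : Continuous fun t : ℝ => y + t • (y - x) := by fun_prop
      simpa using (h.tendsto 0).mono_left nhdsWithin_le_nhds
    obtain ⟨t, ht, ht0⟩ := ((hcont.eventually (isOpen_interior.mem_nhds hy)).and
      self_mem_nhdsWithin).exists
    have h1 := hM e _ (interior_subset ht)
    rw [map_add, map_smul, map_sub, smul_eq_mul, heq] at h1
    nlinarith [mul_pos (show (0 : ℝ) < t from ht0) (sub_pos.2 hxe)]
  by_contra hwC
  let γ : ℝ → V := fun t => AffineMap.lineMap y w t
  have hγ : Continuous γ := AffineMap.lineMap_continuous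
  have hγ1 : γ 1 = w := AffineMap.lineMap_apply_one _ _
  obtain ⟨t, ht, hmax⟩ := (isCompact_Icc.inter_right (hclosed.preimage hγ)).exists_isGreatest
    (s := Icc (0 : ℝ) 1 ∩ γ ⁻¹' C) ⟨0, by simp, by simpa [γ] using hyC⟩
  have ht1 : t < 1 := by
    refine lt_of_le_of_ne ht.1.2 ?_
    rintro rfl
    exact hwC (hγ1 ▸ ht.2)
  have hz : γ t ∉ interior C := fun hz => by
    obtain ⟨s, ⟨hsC, hs1⟩, hs⟩ := (((hγ.tendsto t).mono_left nhdsWithin_le_nhds |>.eventually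
      (isOpen_interior.mem_nhds hz)).and (Filter.Eventually.filter_mono nhdsWithin_le_nhds
        (gt_mem_nhds ht1)) |>.and (self_mem_nhdsWithin (s := Ioi t))).exists
    exact (show ¬ s ≤ t from not_le.2 hs)
      (hmax ⟨⟨ht.1.1.trans (le_of_lt hs), hs1.le⟩, show γ s ∈ C from interior_subset hsC⟩)
  obtain ⟨l, hl⟩ := geometric_hahn_banach_open_point hconv.interior isOpen_interior hz
  obtain ⟨e, he⟩ := hcover (γ t) ht.2 l.toLinearMap (fun a ha => by
    have h1 : a ∈ closure (interior C) := by
      rw [hconv.closure_interior_eq_closure_of_nonempty_interior ⟨y, hy⟩]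
      exact subset_closure ha
    exact closure_minimal (fun b hb => (hl b hb).le)
      (isClosed_le l.continuous continuous_const) h1) ⟨y, hyC, hl y hy⟩
  have h2 : c e (γ t) = c e y + t * (c e w - c e y) := by
    simp only [γ, AffineMap.lineMap_apply_module', map_add, map_smul, map_sub, smul_eq_mul]
    ring
  rw [h2] at he
  nlinarith [hylt e, hw e, mul_nonneg ht.1.1 (sub_nonneg.2 (hw e)),
    mul_pos (sub_pos.2 ht1) (sub_pos.2 (hylt e))]

/-- The relative version of `mem_of_forall_le_of_interior_nonempty`. -/
theorem mem_of_forall_le_of_mem_direction [FiniteDimensional ℝ V] {ι : Type*} {Q : Set V}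
    (hconv : Convex ℝ Q) (hclosed : IsClosed Q) (c : ι → V →ₗ[ℝ] ℝ) (M : ι → ℝ)
    (hM : ∀ e, ∀ x ∈ Q, c e x ≤ M e) (hlt : ∀ e, ∃ x ∈ Q, c e x < M e)
    (hcover : ∀ z ∈ Q, ∀ l : V →ₗ[ℝ] ℝ, (∀ y ∈ Q, l y ≤ l z) → (∃ y ∈ Q, l y < l z) →
      ∃ e, c e z = M e) {q w : V} (hq : q ∈ Q) (hwd : w ∈ (affineSpan ℝ Q).direction)
    (hw : ∀ e, c e (q + w) ≤ M e) : q + w ∈ Q := by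
  set W := (affineSpan ℝ Q).direction with hW
  let τ : W →ᵃ[ℝ] V := W.subtype.toAffineMap + AffineMap.const ℝ W q
  have hτ (a : W) : τ a = q + a := by simp [τ, add_comm]
  have himage : τ '' (τ ⁻¹' Q) = Q := by
    rw [image_preimage_eq_iff]
    intro a ha
    refine ⟨⟨a - q, ?_⟩, by simp [hτ]⟩
    rw [hW, direction_affineSpan]
    exact vsub_mem_vectorSpan ℝ ha hq
  have hsurj {a : V} (ha : a ∈ Q) : ∃ b : W, τ b = a := by
    rw [← himage] at ha
    obtain ⟨b, -, hb⟩ := ha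
    exact ⟨b, hb⟩
  have hCconv : Convex ℝ (τ ⁻¹' Q) := hconv.affine_preimage τ
  have hCclosed : IsClosed (τ ⁻¹' Q) := by
    have : Continuous τ := by
      have h : (τ : W → V) = fun a : W => q + (a : V) := funext hτ
      rw [h]
      fun_prop
    exact hclosed.preimage this
  have hCint : (interior (τ ⁻¹' Q)).Nonempty := by
    rw [hCconv.interior_nonempty_iff_affineSpan_eq_top]
    have hne : (τ ⁻¹' Q).Nonempty := ⟨0, by simpa [hτ] using hq⟩
    rw [← AffineSubspace.direction_eq_top_iff_of_nonempty
      ((affineSpan_nonempty ℝ).2 hne)]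
    have h1 := AffineSubspace.map_direction τ (affineSpan ℝ (τ ⁻¹' Q))
    rw [AffineSubspace.map_span, himage, ← hW] at h1
    have h2 : τ.linear = W.subtype := by simp [τ]
    rw [h2] at h1
    refine Submodule.map_injective_of_injective W.injective_subtype ?_
    rw [← h1, Submodule.map_top, Submodule.range_subtype]
  have hmem : (⟨w, hwd⟩ : W) ∈ τ ⁻¹' Q := by
    refine mem_of_forall_le_of_interior_nonempty (ι := ι) hCconv hCclosed hCint
      (fun e => c e ∘ₗ W.subtype) (fun e => M e - c e q) (fun e a ha => ?_) (fun e => ?_)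
      (fun z hz l hl hl' => ?_) (fun e => ?_)
    · have := hM e _ ha
      rw [hτ, map_add] at this
      simp only [LinearMap.comp_apply, Submodule.subtype_apply]
      linarith
    · obtain ⟨x, hx, hxe⟩ := hlt e
      obtain ⟨b, rfl⟩ := hsurj hx
      refine ⟨b, hx, ?_⟩
      rw [hτ, map_add] at hxe
      simp only [LinearMap.comp_apply, Submodule.subtype_apply]
      linarith
    · obtain ⟨L, rfl⟩ := LinearMap.exists_extend l
      have hL (a : W) : L (τ a) = L q + (L ∘ₗ W.subtype) a := by
        rw [hτ, map_add]; rfl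
      obtain ⟨y, hy, hyl⟩ := hl'
      obtain ⟨e, he⟩ := hcover (τ z) hz L (fun a ha => by
        obtain ⟨b, rfl⟩ := hsurj ha
        rw [hL, hL]
        linarith [hl b ha]) ⟨τ y, hy, by rw [hL, hL]; linarith⟩
      refine ⟨e, ?_⟩
      rw [hτ, map_add] at he
      simp only [LinearMap.comp_apply, Submodule.subtype_apply]
      linarith
    · have := hw e
      rw [map_add] at this
      simp only [LinearMap.comp_apply, Submodule.subtype_apply]
      linarith
  simpa [hτ] using hmem

end HRepresentation

section Facets

variable {r : ℕ} {n : Fin r → ℕ}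

theorem exists_facet_box (hn : ∀ i, 1 ≤ n i) (i : Fin r) (j : Fin (n i + 1)) :
    ∃ τ : Box n, ∀ σ : Box n, σ ≤ τ ↔ j ∉ σ.1 i := by
  classical
  refine ⟨⟨Function.update (fun _ => Finset.univ) i (Finset.univ.erase j), fun i' => ?_⟩,
    fun σ => ?_⟩
  · by_cases h : i' = i
    · subst h
      rw [Function.update_self, ← Finset.card_pos, Finset.card_erase_of_mem (Finset.mem_univ j),
        Finset.card_fin]
      have := hn i'
      omega
    · rw [Function.update_of_ne h]
      exact Finset.univ_nonempty
  · rw [← Subtype.coe_le_coe]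
    constructor
    · intro h hj
      simpa using h i hj
    · intro h i'
      dsimp only
      by_cases h' : i' = i
      · subst h'
        rw [Function.update_self]
        exact fun a ha => Finset.mem_erase.2 ⟨fun h' => h (h' ▸ ha), Finset.mem_univ a⟩
      · rw [Function.update_of_ne h']
        exact fun a _ => Finset.mem_univ a

/-- A description by facets of a polytope whose face poset is that of a product of simplices:
`c i j ≤ M i j` is the inequality of the facet omitting the vertex `j` of the `i`-th factor. -/
structure FacetSystem {V : Type*} [AddCommGroup V] [Module ℝ V] {Q : Set V}
    (G : Box n ≃o facesOf Q) where
  /-- The facet normals. -/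
  c : ∀ i, Fin (n i + 1) → V →ₗ[ℝ] ℝ
  /-- The right-hand sides of the facet inequalities. -/
  M : ∀ i, Fin (n i + 1) → ℝ
  le : ∀ i j, ∀ x ∈ Q, c i j x ≤ M i j
  exists_face : ∀ (T : ∀ i, Finset (Fin (n i + 1))) (x : V), x ∈ Q →
    (∀ i, ∀ j ∈ T i, c i j x = M i j) → ∃ μ : Box n, (∀ i, ∀ j ∈ T i, j ∉ μ.1 i) ∧
      ∀ y, y ∈ (G μ).1 ↔ y ∈ Q ∧ ∀ i, ∀ j ∈ T i, c i j y = M i j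
  eq_of_notMem : ∀ (σ : Box n) (x : V), x ∈ (G σ).1 → ∀ i, ∀ j ∉ σ.1 i, c i j x = M i j
  exists_lt : ∀ (σ : Box n) i, ∀ j ∈ σ.1 i, ∃ x ∈ (G σ).1, c i j x < M i j

variable {V : Type*} [AddCommGroup V] [Module ℝ V] {Q : Set V} {G : Box n ≃o facesOf Q}

theorem nonempty_facetSystem (hn : ∀ i, 1 ≤ n i) (G : Box n ≃o facesOf Q) :
    Nonempty (FacetSystem G) := by
  choose τ hτ using exists_facet_box hn
  choose c M hM hc using fun i j => (G (τ i j)).2.exists_functional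
  refine ⟨⟨c, M, hM, fun T x hx hT => ?_, fun σ x hx i j hj => ?_, fun σ i j hj => ?_⟩⟩
  · have heq : {y ∈ Q | ∀ i, ∀ j ∈ T i, c i j y = M i j} =
        {y ∈ Q | ∀ e ∈ Finset.univ.sigma T, c e.1 e.2 y = M e.1 e.2} := by
      ext y
      simp [Sigma.forall]
    have hF := isFace_of_supporting (Q := Q) (Finset.univ.sigma T) (fun e => c e.1 e.2)
      (fun e => M e.1 e.2) (fun e => hM e.1 e.2) (heq ▸ ⟨x, hx, hT⟩)
    rw [← heq] at hF
    refine ⟨G.symm ⟨_, hF⟩, fun i j hj => ?_, fun y => by simp⟩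
    rw [← hτ, ← G.le_iff_le, OrderIso.apply_symm_apply]
    exact fun y hy => (hc i j y).2 ⟨hy.1, hy.2 i j hj⟩
  · rw [← hτ, ← G.le_iff_le] at hj
    exact ((hc i j x).1 (hj hx)).2
  · have h : ¬ (G σ).1 ⊆ (G (τ i j)).1 := by
      have h := (hτ i j σ).not_left.2 hj
      rwa [← G.le_iff_le] at h
    obtain ⟨x, hx, hxτ⟩ := not_subset.1 h
    have hxQ := (G σ).2.subset hx
    exact ⟨x, hx, lt_of_le_of_ne (hM i j x hxQ) fun he => hxτ ((hc i j x).2 ⟨hxQ, he⟩)⟩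

/-- The point of the face `G σ` in general position can be chosen to satisfy all the relevant facet
inequalities strictly. -/
theorem FacetSystem.exists_relint (Φ : FacetSystem G) (hconv : Convex ℝ Q) (σ : Box n) :
    ∃ x ∈ (G σ).1, ∀ i, ∀ j ∈ σ.1 i, Φ.c i j x < Φ.M i j := by
  classical
  have hσ : Convex ℝ (G σ).1 := by
    obtain ⟨c, M, -, hc⟩ := (G σ).2.exists_functional
    have : (G σ).1 = Q ∩ {x | c x = M} := by
      ext x
      exact hc x
    rw [this]
    exact hconv.inter (convex_hyperplane c.isLinear M)
  suffices h : ∀ T : Finset (Σ i, Fin (n i + 1)), (∀ e ∈ T, e.2 ∈ σ.1 e.1) →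
      ∃ x ∈ (G σ).1, ∀ e ∈ T, Φ.c e.1 e.2 x < Φ.M e.1 e.2 by
    obtain ⟨x, hx, h⟩ := h (Finset.univ.sigma σ.1) (by simp)
    exact ⟨x, hx, fun i j hj => h ⟨i, j⟩ (by simpa using hj)⟩
  intro T
  induction T using Finset.induction with
  | empty => exact fun _ => (G σ).2.1.imp fun x hx => ⟨hx, by simp⟩
  | insert e T _ ih =>
    intro hT
    obtain ⟨x, hx, hxT⟩ := ih fun e he => hT e (Finset.mem_insert_of_mem he)
    obtain ⟨y, hy, hye⟩ := Φ.exists_lt σ e.1 e.2 (hT e (Finset.mem_insert_self e T))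
    refine ⟨(1 / 2 : ℝ) • x + (1 / 2 : ℝ) • y,
      hσ hx hy (by norm_num) (by norm_num) (by norm_num), fun e' he' => ?_⟩
    have h1 := Φ.le e'.1 e'.2 x ((G σ).2.subset hx)
    have h2 := Φ.le e'.1 e'.2 y ((G σ).2.subset hy)
    simp only [map_add, map_smul, smul_eq_mul]
    rcases Finset.mem_insert.1 he' with rfl | he'
    · linarith
    · linarith [hxT e' he']

theorem boxDim_mono {σ τ : Box n} (h : σ ≤ τ) : boxDim σ ≤ boxDim τ :=
  Finset.sum_le_sum fun i _ => Nat.sub_le_sub_right (Finset.card_le_card (h i)) 1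

theorem boxDim_le_polyDim [FiniteDimensional ℝ V] (G : Box n ≃o facesOf Q) (σ : Box n) :
    boxDim σ ≤ polyDim (G σ).1 := by
  classical
  induction h : boxDim σ generalizing σ with
  | zero => exact Nat.zero_le _
  | succ m ih =>
    have hpos : ∃ i, 1 < (σ.1 i).card := by
      by_contra! hle
      have : boxDim σ = 0 := Finset.sum_eq_zero fun i _ => Nat.sub_eq_zero_of_le (hle i)
      omega
    obtain ⟨i, hi⟩ := hpos
    obtain ⟨j, hj⟩ := σ.2 i
    let τ : Box n := ⟨Function.update σ.1 i ((σ.1 i).erase j), fun i' => by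
      by_cases h : i' = i
      · subst h
        rw [Function.update_self, ← Finset.card_pos, Finset.card_erase_of_mem hj]
        omega
      · rw [Function.update_of_ne h]
        exact σ.2 i'⟩
    have hτi : τ.1 i = (σ.1 i).erase j := Function.update_self ..
    have hτne (i') (h : i' ≠ i) : τ.1 i' = σ.1 i' := Function.update_of_ne h ..
    have hτσ : τ ≤ σ := fun i' => by
      by_cases h : i' = i
      · subst h
        rw [hτi]
        exact Finset.erase_subset _ _
      · rw [hτne i' h]
    have hdim : boxDim τ + 1 = boxDim σ := by
      rw [boxDim, boxDim, ← Finset.add_sum_erase _ _ (Finset.mem_univ i),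
        ← Finset.add_sum_erase _ _ (Finset.mem_univ i), hτi, Finset.card_erase_of_mem hj,
        Finset.sum_congr rfl fun i' hi' => by rw [hτne i' (Finset.ne_of_mem_erase hi')]]
      omega
    have hlt : G τ < G σ := by
      rw [G.lt_iff_lt]
      refine lt_of_le_of_ne hτσ fun h => ?_
      rw [← h, hτi] at hj
      simp at hj
    have h1 := ih τ (by omega)
    have h2 : polyDim (G τ).1 < polyDim (G σ).1 :=
      polyDim_lt_of_ssubset (G τ).2 (G σ).2.subset hlt
    omega

end Facets

section Geometry

variable {r : ℕ} {n : Fin r → ℕ} {V : Type*} [NormedAddCommGroup V] [NormedSpace ℝ V]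
  [FiniteDimensional ℝ V] {Q : Set V} {G : Box n ≃o facesOf Q}

theorem FacetSystem.mem_of_le (Φ : FacetSystem G) (hconv : Convex ℝ Q) (hclosed : IsClosed Q)
    {q w : V} (hq : q ∈ Q) (hw : w ∈ (affineSpan ℝ Q).direction)
    (h : ∀ i j, Φ.c i j (q + w) ≤ Φ.M i j) : q + w ∈ Q := by
  refine mem_of_forall_le_of_mem_direction (ι := Σ i, Fin (n i + 1)) hconv hclosed
    (fun e => Φ.c e.1 e.2) (fun e => Φ.M e.1 e.2) (fun e => Φ.le e.1 e.2) (fun e => ?_)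
    (fun z hz l hl hl' => ?_) hq hw (fun e => h e.1 e.2)
  · obtain ⟨x, hx, hxe⟩ := Φ.exists_lt ⟨fun _ => Finset.univ, fun _ => Finset.univ_nonempty⟩
      e.1 e.2 (Finset.mem_univ _)
    exact ⟨x, (G _).2.subset hx, hxe⟩
  · have hF : IsFace Q {x ∈ Q | ∀ y ∈ Q, l y ≤ l x} := ⟨⟨z, hz, hl⟩, l, rfl⟩
    obtain ⟨μ, hμ⟩ := G.surjective ⟨_, hF⟩
    have hzμ : z ∈ (G μ).1 := by
      rw [hμ]
      exact ⟨hz, hl⟩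
    by_contra! hne
    have htop (σ : Box n) : σ ≤ μ := fun i j _ => by
      by_contra hj
      exact hne ⟨i, j⟩ (Φ.eq_of_notMem μ z hzμ i j hj)
    obtain ⟨y, hy, hyl⟩ := hl'
    have hQ : IsFace Q Q := ⟨⟨z, hz⟩, 0, by simp⟩
    have h1 : Q ⊆ (G μ).1 := by
      have := G.monotone (htop (G.symm ⟨Q, hQ⟩))
      rwa [OrderIso.apply_symm_apply] at this
    have h2 := h1 hy
    rw [hμ] at h2
    exact not_lt.2 (h2.2 z hz) hyl

/-- If the low-dimensional faces are saturated with respect to `f`, then no nonzero kernel direction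
stays within the facets missing a low-dimensional face. -/
theorem FacetSystem.exists_pos_of_saturated (Φ : FacetSystem G) (hconv : Convex ℝ Q)
    (hcomp : IsCompact Q) {E : Type*} [AddCommGroup E] [Module ℝ E] {f : V →ₗ[ℝ] E} {k : ℕ}
    (hsat : ∀ ρ : Box n, boxDim ρ ≤ k → ∀ x ∈ Q, ∀ z ∈ (G ρ).1, f x = f z → x ∈ (G ρ).1)
    {u : V} (hu : u ∈ (affineSpan ℝ Q).direction) (hfu : f u = 0) (hu0 : u ≠ 0) {σ : Box n}
    (hσ : boxDim σ ≤ k) : ∃ i, ∃ j ∉ σ.1 i, 0 < Φ.c i j u := by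
  by_contra! hneg
  have hstep (x) (hx : x ∈ Q) (hlt : ∀ i, ∀ j ∈ σ.1 i, Φ.c i j x < Φ.M i j) :
      ∃ t : ℝ, 0 < t ∧ x + t • u ∈ Q := by
    have h1 : ∀ᶠ t in nhdsWithin (0 : ℝ) (Ioi 0), ∀ i j, Φ.c i j (x + t • u) ≤ Φ.M i j := by
      rw [Filter.eventually_all]
      intro i
      rw [Filter.eventually_all]
      intro j
      by_cases hj : j ∈ σ.1 i
      · have h2 : Filter.Tendsto (fun t : ℝ => Φ.c i j x + t * Φ.c i j u) (nhdsWithin 0 (Ioi 0))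
            (nhds (Φ.c i j x)) := by
          have h : Continuous fun t : ℝ => Φ.c i j x + t * Φ.c i j u := by fun_prop
          simpa using (h.tendsto 0).mono_left nhdsWithin_le_nhds
        filter_upwards [h2.eventually (gt_mem_nhds (hlt i j hj))] with t ht
        rw [map_add, map_smul, smul_eq_mul]
        exact ht.le
      · filter_upwards [self_mem_nhdsWithin] with t ht
        rw [map_add, map_smul, smul_eq_mul]
        nlinarith [mul_nonneg (le_of_lt (show (0 : ℝ) < t from ht))
          (neg_nonneg.2 (hneg i j hj)), Φ.le i j x hx]
    obtain ⟨t, ht, ht0⟩ := (h1.and self_mem_nhdsWithin).exists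
    exact ⟨t, ht0, Φ.mem_of_le hconv hcomp.isClosed hx (Submodule.smul_mem _ t hu) ht⟩
  obtain ⟨x, hxσ, hx⟩ := Φ.exists_relint hconv σ
  have hxQ := (G σ).2.subset hxσ
  have hT : IsCompact {t : ℝ | 0 ≤ t ∧ x + t • u ∈ Q} := by
    refine Metric.isCompact_of_isClosed_isBounded ?_ ?_
    · exact (isClosed_Ici (a := (0 : ℝ))).inter (hcomp.isClosed.preimage (by fun_prop))
    · obtain ⟨R, hR⟩ := hcomp.isBounded.exists_norm_le
      refine (Metric.isBounded_Icc (0 : ℝ) ((R + ‖x‖) / ‖u‖)).subset fun t ht => ⟨ht.1, ?_⟩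
      rw [le_div_iff₀ (norm_pos_iff.2 hu0)]
      have h1 : ‖t • u‖ ≤ ‖x + t • u‖ + ‖x‖ := by
        simpa using norm_sub_le (x + t • u) x
      rw [norm_smul, Real.norm_of_nonneg ht.1] at h1
      linarith [hR _ ht.2]
  obtain ⟨t, ht, hmax⟩ := hT.exists_isGreatest ⟨0, le_rfl, by simpa using hxQ⟩
  have hfz (s : ℝ) : f (x + s • u) = f x := by simp [hfu]
  have hzσ := hsat σ hσ _ ht.2 x hxσ (hfz t)
  classical
  obtain ⟨μ, hμT, hμ⟩ := Φ.exists_face (fun i => Finset.univ.filter fun j =>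
    Φ.c i j (x + t • u) = Φ.M i j) (x + t • u) ht.2 (fun i j hj => by simpa using hj)
  have hzμ : x + t • u ∈ (G μ).1 := (hμ _).2 ⟨ht.2, fun i j hj => by simpa using hj⟩
  have hμσ : μ ≤ σ := fun i j hj => by
    by_contra hj'
    exact hμT i j (by simpa using Φ.eq_of_notMem σ _ hzσ i j hj') hj
  have hxμ := hsat μ ((boxDim_mono hμσ).trans hσ) x hxQ _ hzμ (hfz t).symm
  obtain ⟨s, hs, hsQ⟩ := hstep _ ht.2 fun i j hj => by
    refine lt_of_le_of_ne (Φ.le i j _ ht.2) fun he => ?_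
    exact (hx i j hj).ne (((hμ x).1 hxμ).2 i j (by simpa using he))
  have := hmax ⟨add_nonneg ht.1 hs.le, by rwa [add_smul, ← add_assoc]⟩
  linarith

/-- The kernel of a projection preserving the `k`-skeleton of a product of simplices carries a
system of functionals, one for each facet, such that many of them are positive at each vector. -/
theorem exists_weight_functionals (hn : ∀ i, 1 ≤ n i) (hQ : IsPolytope Q)
    (G : Box n ≃o facesOf Q) {E : Type*} [AddCommGroup E] [Module ℝ E] [FiniteDimensional ℝ E]
    {f : V →ₗ[ℝ] E} {k : ℕ} (hk : SkelEquiv k (f '' Q) (prodSimplex n)) :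
    ∃ (W : Submodule ℝ V) (U : Submodule ℝ W) (g : ∀ i, Fin (n i + 1) → U →ₗ[ℝ] ℝ),
      ∑ i, n i ≤ Module.finrank ℝ U + polyDim (f '' Q) ∧
      ∀ u : U, u ≠ 0 → k + 1 ≤ ∑ i, ((Finset.univ.filter fun j => 0 < g i j u).card - 1) := by
  classical
  obtain ⟨Φ⟩ := nonempty_facetSystem hn G
  have hconv : Convex ℝ Q := by
    obtain ⟨S, rfl⟩ := hQ
    exact convex_convexHull ℝ _
  have hcomp : IsCompact Q := by
    obtain ⟨S, rfl⟩ := hQ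
    exact S.finite_toSet.isCompact_convexHull (𝕜 := ℝ)
  refine ⟨(affineSpan ℝ Q).direction, LinearMap.ker (f.domRestrict (affineSpan ℝ Q).direction),
    fun i j => Φ.c i j ∘ₗ Submodule.subtype _ ∘ₗ Submodule.subtype _, ?_, fun u hu => ?_⟩
  · let σ : Box n := ⟨fun _ => Finset.univ, fun _ => Finset.univ_nonempty⟩
    have h1 : ∑ i, n i = boxDim σ := by simp [boxDim, σ]
    have h2 := (boxDim_le_polyDim G σ).trans (polyDim_mono (G σ).2.subset)
    have h3 : polyDim (f '' Q) =
        Module.finrank ℝ (LinearMap.range (f.domRestrict (affineSpan ℝ Q).direction)) := by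
      rw [polyDim, direction_affineSpan, LinearMap.range_domRestrict, direction_affineSpan]
      have := AffineMap.map_vectorSpan f.toAffineMap (s := Q)
      rw [LinearMap.toAffineMap_linear, LinearMap.coe_toAffineMap] at this
      rw [this]
    have h4 := LinearMap.finrank_range_add_finrank_ker
      (f.domRestrict (affineSpan ℝ Q).direction)
    rw [polyDim] at h2
    omega
  · by_contra! hlt
    let X (i : Fin r) : Finset (Fin (n i + 1)) := Finset.univ.filter fun j => 0 < Φ.c i j u
    let σ : Box n := ⟨fun i => if (X i).Nonempty then X i else {0}, fun i => by
      dsimp only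
      split_ifs with h
      · exact h
      · simp⟩
    have hσ : boxDim σ ≤ k := by
      refine (Finset.sum_le_sum fun i _ => ?_).trans (Nat.lt_succ_iff.1 hlt)
      simp only [σ]
      split_ifs with h
      · exact le_rfl
      · simp
    obtain ⟨i, j, hj, hpos⟩ := Φ.exists_pos_of_saturated hconv hcomp
      (fun ρ hρ x hx z hz => mem_face_of_apply_eq G hk hρ hx hz) (u := u) u.1.2
      (LinearMap.mem_ker.1 u.2) (by simpa using hu) hσ
    have hjX : j ∈ X i := by simpa [X] using hpos
    apply hj
    simp only [σ]
    rw [if_pos ⟨j, hjX⟩]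
    exact hjX

end Geometry

section Numerics

variable {r k : ℕ} {n : Fin r → ℕ} {A B : Finset (Fin r)}

theorem exists_le_sum_add_eq {ι : Type*} (s : Finset ι) (u : ι → ℕ) (v : ℕ) {t : ℕ}
    (ht : t ≤ ∑ i ∈ s, u i + v) :
    ∃ (a : ι → ℕ) (b : ℕ), (∀ i, a i ≤ u i) ∧ b ≤ v ∧ ∑ i ∈ s, a i + b = t := by
  obtain ⟨a, ha, hsum⟩ := exists_le_sum_eq s u (min_le_right t (∑ i ∈ s, u i))
  exact ⟨a, t - min t (∑ i ∈ s, u i), ha, by omega, by omega⟩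

theorem IsPPSN.card_add_le_polyDim {E : Type*} [AddCommGroup E] [Module ℝ E]
    [FiniteDimensional ℝ E] {P : Set E} (hP : IsPPSN k n P) (hr : 1 ≤ r) (hn : ∀ i, 1 ≤ n i)
    (hdisj : Disjoint A B) (hunion : A ∪ B = Finset.univ) (a o : Fin r → ℕ) (b p : ℕ)
    (hA : ∀ i ∈ A, 2 * a i + 2 ≤ n i + o i)
    (hB : if B.Nonempty then 2 * b + 1 ≤ ∑ i ∈ B, n i + p else b = 0)
    (hk : ∑ i ∈ A, a i + b ≤ k) :
    1 + A.card + 2 * (∑ i ∈ A, a i + b) ≤ polyDim P + ∑ i ∈ A, o i + p := by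
  classical
  obtain ⟨⟨-, hskel⟩, N, Q, f, hQ, rfl, ⟨e⟩⟩ := hP
  obtain ⟨W, U, g, hdim, hg⟩ :=
    exists_weight_functionals hn hQ ((boxEquiv n).trans e.symm) hskel
  obtain ⟨ρ, hρ, hρsum⟩ := exists_le_sum_eq B n (min_le_left (∑ i ∈ B, n i) (2 * b + 1))
  have hR (i) : ∃ R : Finset (Fin (n i + 1)),
      R.card = if i ∈ A then min (n i + 1) (2 * a i + 3) else 1 + ρ i := by
    obtain ⟨R, -, hR⟩ := Finset.exists_subset_card_eq (s := (Finset.univ : Finset (Fin (n i + 1))))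
      (n := if i ∈ A then min (n i + 1) (2 * a i + 3) else 1 + ρ i) (by
        have := hρ i
        rw [Finset.card_fin]
        split_ifs <;> omega)
    exact ⟨R, hR⟩
  choose R hR using hR
  have hRA (i) (hi : i ∈ A) : (R i).card = min (n i + 1) (2 * a i + 3) := by rw [hR, if_pos hi]
  have hRB (i) (hi : i ∈ B) : (R i).card = 1 + ρ i := by
    rw [hR, if_neg (Finset.disjoint_right.1 hdisj hi)]
  have h1 := finrank_le_of_weight g hg hdisj hunion R a b
    (fun i hi => (hRA i hi).trans_le (min_le_right _ _))
    (by
      rw [Finset.sum_congr rfl fun i hi => by rw [hRB i hi, Nat.add_sub_cancel_left], hρsum]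
      exact min_le_right _ _) hk
  rw [← hunion, Finset.sum_union hdisj] at h1 hdim
  have h2 : ∑ i ∈ A, (n i + 1 - (R i).card) + 2 * ∑ i ∈ A, a i + 2 * A.card
      ≤ ∑ i ∈ A, n i + ∑ i ∈ A, o i := by
    rw [Finset.mul_sum, Finset.card_eq_sum_ones, Finset.mul_sum, ← Finset.sum_add_distrib,
      ← Finset.sum_add_distrib, ← Finset.sum_add_distrib]
    refine Finset.sum_le_sum fun i hi => ?_
    have := hA i hi
    rw [hRA i hi]
    omega
  have h3 : ∑ i ∈ B, (n i + 1 - (R i).card) + ∑ i ∈ B, ρ i = ∑ i ∈ B, n i := by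
    rw [← Finset.sum_add_distrib]
    refine Finset.sum_congr rfl fun i hi => ?_
    have := hρ i
    rw [hRB i hi]
    omega
  have h4 : A.card + B.card = r := by
    rw [← Finset.card_union_of_disjoint hdisj, hunion, Finset.card_fin]
  split_ifs at h1 hB with h
  · omega
  · rw [Finset.not_nonempty_iff_eq_empty] at h
    subst h
    simp only [Finset.sum_empty, Finset.card_empty] at *
    omega

/-- The bound for `k` at most `K₁`. -/
theorem IsPPSN.add_two_mul_le_polyDim {E : Type*} [AddCommGroup E] [Module ℝ E]
    [FiniteDimensional ℝ E] {P : Set E} (hP : IsPPSN k n P) (hr : 1 ≤ r) (hn : ∀ i, 1 ≤ n i)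
    (hdisj : Disjoint A B) (hunion : A ∪ B = Finset.univ) (hA : ∀ i ∈ A, 2 ≤ n i)
    (hk : k ≤ ∑ i ∈ A, (n i - 2) / 2 + (∑ i ∈ B, n i - 1) / 2) :
    1 + A.card + 2 * k ≤ polyDim P := by
  obtain ⟨a, b, ha, hb, rfl⟩ := exists_le_sum_add_eq A _ _ hk
  have := hP.card_add_le_polyDim hr hn hdisj hunion a 0 b 0 (fun i hi => ?_) ?_ le_rfl
  · simpa using this
  · have h1 := ha i
    have h2 := hA i hi
    simp only [Pi.zero_apply]
    omega
  · split_ifs with h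
    · have := Finset.sum_pos (f := n) (fun i _ => hn i) h
      omega
    · rw [Finset.not_nonempty_iff_eq_empty] at h
      subst h
      simp only [Finset.sum_empty] at hb
      omega

/-- The bound for `k` at least `K₁`. -/
theorem IsPPSN.two_mul_add_le_polyDim {E : Type*} [AddCommGroup E] [Module ℝ E]
    [FiniteDimensional ℝ E] {P : Set E} (hP : IsPPSN k n P) (hr : 1 ≤ r) (hn : ∀ i, 1 ≤ n i)
    (hdisj : Disjoint A B) (hunion : A ∪ B = Finset.univ) (hA : ∀ i ∈ A, 2 ≤ n i) {t : ℕ}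
    (ht : t ≤ (A.filter fun i => Odd (n i)).card
      + if Even (∑ i ∈ B, n i) ∧ ∑ i ∈ B, n i ≠ 0 then 1 else 0)
    (hk : ∑ i ∈ A, (n i - 2) / 2 + (∑ i ∈ B, n i - 1) / 2 + t ≤ k) :
    1 + A.card + 2 * (∑ i ∈ A, (n i - 2) / 2 + (∑ i ∈ B, n i - 1) / 2) + t ≤ polyDim P := by
  rw [Finset.card_filter] at ht
  obtain ⟨o, p, ho, hp, rfl⟩ := exists_le_sum_add_eq A _ _ ht
  have := hP.card_add_le_polyDim hr hn hdisj hunion (fun i => (n i - 2) / 2 + o i) o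
    ((∑ i ∈ B, n i - 1) / 2 + p) p (fun i hi => ?_) ?_ ?_
  · rw [Finset.sum_add_distrib] at this
    omega
  · have h1 := ho i
    have h2 := hA i hi
    beta_reduce at h1 ⊢
    split_ifs at h1 with h
    · obtain ⟨m, hm⟩ := h
      omega
    · omega
  · split_ifs with h
    · have h2 := Finset.sum_pos (f := n) (fun i _ => hn i) h
      split_ifs at hp with h3
      · obtain ⟨⟨m, hm⟩, -⟩ := h3
        omega
      · omega
    · rw [Finset.not_nonempty_iff_eq_empty] at h
      subst h
      simp only [Finset.sum_empty, ne_eq, not_true, and_false, if_false] at hp ⊢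
      omega
  · rw [Finset.sum_add_distrib]
    omega

end Numerics

/-- Theorem `topObstr-all-k`. For a partition `[r] = A ⊎ B` with
`B ⊇ S = {i : n_i = 1}`, set `n_B = Σ_{i∈B} n_i`,
`K₁ = Σ_{i∈A} ⌊(n_i-2)/2⌋ + max{0, ⌊(n_B-1)/2⌋}` and
`K₂ = |{i ∈ A : n_i odd}| + (1 if n_B is even and nonzero else 0)`. Then every
`(k,n̄)`-PPSN polytope has dimension at least `r+1-|B|+2k` if `k ≤ K₁`, at least
`r+1-|B|+K₁+k` if `K₁ ≤ k ≤ K₁+K₂`, and at least `r+1-|B|+2K₁+K₂` if `k ≥ K₁+K₂`. -/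
theorem statement15 (k r : ℕ) (hr : 1 ≤ r) (n : Fin r → ℕ) (hn : ∀ i, 1 ≤ n i)
    (A B : Finset (Fin r)) (hdisj : Disjoint A B) (hunion : A ∪ B = Finset.univ)
    (hSB : Finset.univ.filter (fun i : Fin r => n i = 1) ⊆ B) :
    (k ≤ (∑ i ∈ A, (n i - 2) / 2) + max 0 (((∑ i ∈ B, n i) - 1) / 2) →
      ∀ (d : ℕ) (P : Set (Fin d → ℝ)), IsPPSN k n P →
        r + 1 - B.card + 2 * k ≤ polyDim P) ∧
    ((∑ i ∈ A, (n i - 2) / 2) + max 0 (((∑ i ∈ B, n i) - 1) / 2) ≤ k →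
      k ≤ ((∑ i ∈ A, (n i - 2) / 2) + max 0 (((∑ i ∈ B, n i) - 1) / 2))
          + ((A.filter (fun i => Odd (n i))).card
              + (if Even (∑ i ∈ B, n i) ∧ (∑ i ∈ B, n i) ≠ 0 then 1 else 0)) →
      ∀ (d : ℕ) (P : Set (Fin d → ℝ)), IsPPSN k n P →
        r + 1 - B.card + ((∑ i ∈ A, (n i - 2) / 2) + max 0 (((∑ i ∈ B, n i) - 1) / 2)) + k
          ≤ polyDim P) ∧
    (((∑ i ∈ A, (n i - 2) / 2) + max 0 (((∑ i ∈ B, n i) - 1) / 2))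
          + ((A.filter (fun i => Odd (n i))).card
              + (if Even (∑ i ∈ B, n i) ∧ (∑ i ∈ B, n i) ≠ 0 then 1 else 0)) ≤ k →
      ∀ (d : ℕ) (P : Set (Fin d → ℝ)), IsPPSN k n P →
        r + 1 - B.card
          + 2 * ((∑ i ∈ A, (n i - 2) / 2) + max 0 (((∑ i ∈ B, n i) - 1) / 2))
          + ((A.filter (fun i => Odd (n i))).card
              + (if Even (∑ i ∈ B, n i) ∧ (∑ i ∈ B, n i) ≠ 0 then 1 else 0))
          ≤ polyDim P) := by
  have hcard : A.card + B.card = r := by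
    rw [← Finset.card_union_of_disjoint hdisj, hunion, Finset.card_fin]
  have hA : ∀ i ∈ A, 2 ≤ n i := fun i hi => by
    have h1 : n i ≠ 1 := fun h =>
      Finset.disjoint_left.1 hdisj hi (hSB (by simpa using h))
    have := hn i
    omega
  simp only [Nat.zero_max]
  refine ⟨fun hk d P hP => ?_, fun hk hk' d P hP => ?_, fun hk d P hP => ?_⟩
  · have := hP.add_two_mul_le_polyDim hr hn hdisj hunion hA hk
    omega
  · obtain ⟨t, rfl⟩ := Nat.exists_eq_add_of_le hk
    have := hP.two_mul_add_le_polyDim hr hn hdisj hunion hA (Nat.add_le_add_iff_left.1 hk') le_rfl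
    omega
  · have := hP.two_mul_add_le_polyDim hr hn hdisj hunion hA le_rfl hk
    omega
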